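/- Let $d\ge 1$, $T>0$ and $\alpha\in(0,\min(2,d))$. There exists a constant $C>0$ such that for all integers $n\ge 2$ and $m\ge 1$: $\sup_{x\in Q}\int_0^{T} \bigl\|(G_d)^n(t,x,\cdot)-(G_d)^{n,m}(t+T/m,x,\cdot)\bigr\|_{(\alpha)}^2\, dt \le C\, m^{-1+\alpha/2}$. -/

import Mathlib

open MeasureTheory

/-- `φ_j(ξ) = √2 sin(jπξ)`. -/
noncomputable def phiF (j : ℕ) (ξ : ℝ) : ℝ := Real.sqrt 2 * Real.sin ((j : ℝ) * Real.pi * ξ)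

/-- Green function of the heat operator on `[0,1]` with homogeneous
Dirichlet boundary conditions: `G(t,x,y) = ∑_{j≥1} e^{-j²π²t} φ_j(x) φ_j(y)`. -/
noncomputable def G (t x y : ℝ) : ℝ :=
  ∑' j : ℕ, Real.exp (-((j : ℝ) + 1) ^ 2 * Real.pi ^ 2 * t) * phiF (j + 1) x * phiF (j + 1) y

/-- The cube `Q = [0,1]^d`. -/
def Q (d : ℕ) : Set (EuclideanSpace ℝ (Fin d)) := {x | ∀ i, x i ∈ Set.Icc (0 : ℝ) 1}

/-- `G_d(t,x,y) = ∏_i G(t,x_i,y_i)` on `Q = [0,1]^d`. -/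
noncomputable def Gd (d : ℕ) (t : ℝ) (x y : EuclideanSpace ℝ (Fin d)) : ℝ :=
  ∏ i, G t (x i) (y i)

/-- `‖φ‖_{(α)}² = ∫_Q ∫_Q |φ(y)| |y-z|^{-α} |φ(z)| dy dz`. -/
noncomputable def normAlphaSq (d : ℕ) (α : ℝ) (f : EuclideanSpace ℝ (Fin d) → ℝ) : ℝ :=
  ∫ y in Q d, ∫ z in Q d, |f y| * ‖y - z‖ ^ (-α) * |f z|

/-- `κ_n(y) = ⌊ny⌋/n`. -/
noncomputable def kappa (n : ℕ) (y : ℝ) : ℝ := (⌊(n : ℝ) * y⌋ : ℝ) / n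

/-- `λ_j^n = -4n² sin²(jπ/(2n))`. -/
noncomputable def lamn (n j : ℕ) : ℝ :=
  -4 * (n : ℝ) ^ 2 * Real.sin ((j : ℝ) * Real.pi / (2 * n)) ^ 2

/-- Piecewise-linear interpolation of `φ_j` on the grid `{i/n : 0 ≤ i ≤ n}`. -/
noncomputable def phiLin (n j : ℕ) (x : ℝ) : ℝ :=
  phiF j ((⌊(n : ℝ) * x⌋ : ℝ) / n) +
    ((n : ℝ) * x - (⌊(n : ℝ) * x⌋ : ℝ)) *
      (phiF j (((⌊(n : ℝ) * x⌋ : ℝ) + 1) / n) - phiF j ((⌊(n : ℝ) * x⌋ : ℝ) / n))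

/-- Space-discretized Green function on `[0,1]`:
`G^n(t,x,y) = ∑_{j=1}^{n-1} e^{λ_j^n t} φ_j^n(x) φ_j(κ_n(y))`. -/
noncomputable def Gn (n : ℕ) (t x y : ℝ) : ℝ :=
  ∑ j ∈ Finset.Icc 1 (n - 1), Real.exp (lamn n j * t) * phiLin n j x * phiF j (kappa n y)

/-- `(G_d)^n(t,x,y) = ∏_i G^n(t,x_i,y_i)`. -/
noncomputable def Gdn (d n : ℕ) (t : ℝ) (x y : EuclideanSpace ℝ (Fin d)) : ℝ :=
  ∏ i, Gn n t (x i) (y i)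

/-- Implicit space-time discretized Green function
`(G_d)^{n,m}(t,x,y) = ∑_{k ∈ {1,…,n-1}^d} (1 - (T/m) λ_k^n)^{-⌊mt/T⌋} φ_k^n(x) φ_k(κ_n(y))`. -/
noncomputable def Gdnm (d : ℕ) (T : ℝ) (n m : ℕ) (t : ℝ)
    (x y : EuclideanSpace ℝ (Fin d)) : ℝ :=
  ∑ k ∈ Finset.Icc (fun _ : Fin d => 1) (fun _ : Fin d => n - 1),
    (1 - T / (m : ℝ) * ∑ i, lamn n (k i)) ^ (-⌊(m : ℝ) * t / T⌋) *
      (∏ i, phiLin n (k i) (x i)) * ∏ i, phiF (k i) (kappa n (y i))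

lemma sum_inv_sq (L : ℝ) (hL : 0 < L) (N : ℕ) :
    ∑ k ∈ Finset.range N, 1 / (1 + (((k : ℝ) + 1) / L) ^ 2) ≤ 2 * L := by
  have key : ∑ k ∈ Finset.range N, 1 / (1 + (((k : ℝ) + 1) / L) ^ 2)
      ≤ 2 * L - 2 * L ^ 2 / (L + N) := by
    induction N with
    | zero => simp; field_simp; simp
    | succ N ih =>
      rw [Finset.sum_range_succ]
      have hN : (0 : ℝ) ≤ N := Nat.cast_nonneg N
      have h1 : 1 / (1 + (((N : ℝ) + 1) / L) ^ 2) ≤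
          2 * L ^ 2 / (L + N) - 2 * L ^ 2 / (L + (N + 1 : ℕ)) := by
        push_cast
        have e : 2 * L ^ 2 / (L + N) - 2 * L ^ 2 / (L + (N + 1)) =
            2 * L ^ 2 / ((L + N) * (L + (N + 1))) := by
          field_simp; ring
        have e2 : 1 / (1 + (((N : ℝ) + 1) / L) ^ 2) = 2 * L ^ 2 / (2 * (L ^ 2 + (N + 1) ^ 2)) := by
          field_simp
        rw [e, e2]
        apply div_le_div_of_nonneg_left (by positivity) (by positivity)
        nlinarith [sq_nonneg (L - (N + 1))]
      linarith
  have : 0 ≤ 2 * L ^ 2 / (L + N) := by positivity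
  linarith

lemma cos_sum_zero (n : ℕ) (hn : 0 < n) (m : ℤ) (hm0 : m ≠ 0) (hm : |m| < 2 * n) :
    ∑ c ∈ Finset.range (2 * n), Real.cos ((m : ℝ) * Real.pi * c / n) = 0 := by
  have hn' : (n : ℝ) ≠ 0 := by positivity
  set θ : ℝ := (m : ℝ) * Real.pi / n with hθ
  have hs : Real.sin (θ / 2) ≠ 0 := by
    intro h
    rw [Real.sin_eq_zero_iff] at h
    obtain ⟨k, hk⟩ := h
    rw [hθ] at hk
    have : (m : ℝ) = k * (2 * n) := by
      field_simp at hk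
      linarith
    have h2 : m = k * (2 * n) := by exact_mod_cast this
    rw [h2, abs_mul] at hm
    have hk0 : k ≠ 0 := by rintro rfl; simp at h2; exact hm0 h2
    have : 1 ≤ |k| := Int.one_le_abs hk0
    have h3 : |(2 * (n : ℤ))| = 2 * n := abs_of_nonneg (by positivity)
    rw [h3] at hm
    nlinarith
  have tel : ∀ N : ℕ, 2 * Real.sin (θ / 2) * ∑ c ∈ Finset.range N, Real.cos ((m : ℝ) * Real.pi * c / n)
      = Real.sin (N * θ - θ / 2) + Real.sin (θ / 2) := by
    intro N
    induction N with
    | zero => simp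
    | succ N ih =>
      rw [Finset.sum_range_succ, mul_add, ih]
      have : (m : ℝ) * Real.pi * N / n = N * θ := by rw [hθ]; ring
      rw [this]
      have e1 : ((N + 1 : ℕ) : ℝ) * θ - θ / 2 = N * θ + θ / 2 := by push_cast; ring
      rw [e1, Real.sin_sub, Real.sin_add]; ring
  have h := tel (2 * n)
  have e : ((2 * n : ℕ) : ℝ) * θ - θ / 2 = -(θ / 2) + (m : ℝ) * (2 * Real.pi) := by
    rw [hθ]; push_cast; field_simp; ring
  rw [e, Real.sin_add_int_mul_two_pi, Real.sin_neg] at h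
  have h' : 2 * Real.sin (θ / 2) * ∑ c ∈ Finset.range (2 * n), Real.cos ((m : ℝ) * Real.pi * c / n) = 0 := by
    rw [h]; ring
  rcases mul_eq_zero.mp h' with h | h
  · exact absurd (by linarith) hs
  · exact h

lemma parseval_gen {ι : Type*} [DecidableEq ι] (s : Finset ι) (M : ℕ) (u : ι → ℕ → ℝ) (b : ι → ℝ) (A : ℝ)
    (h : ∀ j ∈ s, ∀ k ∈ s, ∑ c ∈ Finset.range M, u j c * u k c = if j = k then A else 0) :
    ∑ c ∈ Finset.range M, (∑ j ∈ s, b j * u j c) ^ 2 = A * ∑ j ∈ s, b j ^ 2 := by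
  have : ∀ c, (∑ j ∈ s, b j * u j c) ^ 2 = ∑ j ∈ s, ∑ k ∈ s, b j * b k * (u j c * u k c) := by
    intro c
    rw [sq, Finset.sum_mul_sum]
    refine Finset.sum_congr rfl fun j _ => Finset.sum_congr rfl fun k _ => by ring
  simp_rw [this]
  rw [Finset.sum_comm, Finset.mul_sum]
  refine Finset.sum_congr rfl fun j hj => ?_
  rw [Finset.sum_comm]
  simp_rw [← Finset.mul_sum]
  rw [Finset.sum_congr rfl (fun k hk => by rw [h j hj k hk])]
  simp [hj]; ring

lemma parseval_sin (n : ℕ) (hn : 0 < n) (b : ℕ → ℝ) :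
    ∑ c ∈ Finset.range (2 * n), (∑ j ∈ Finset.range n,
      b j * Real.sin ((2 * (j : ℝ) + 1) * (Real.pi * c / (2 * n)))) ^ 2
      = n * ∑ j ∈ Finset.range n, b j ^ 2 := by
  have hn' : (n : ℝ) ≠ 0 := by positivity
  apply parseval_gen (Finset.range n) (2 * n)
    (fun j c => Real.sin ((2 * (j : ℝ) + 1) * (Real.pi * c / (2 * n)))) b n
  intro j hj k hk
  simp only [Finset.mem_range] at hj hk
  have : ∀ c : ℕ, Real.sin ((2 * (j : ℝ) + 1) * (Real.pi * c / (2 * n))) *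
      Real.sin ((2 * (k : ℝ) + 1) * (Real.pi * c / (2 * n))) =
      (1 / 2) * Real.cos ((((j : ℤ) - k : ℤ) : ℝ) * Real.pi * c / n) -
      (1 / 2) * Real.cos ((((j : ℤ) + k + 1 : ℤ) : ℝ) * Real.pi * c / n) := by
    intro c
    set X := (2 * (j : ℝ) + 1) * (Real.pi * c / (2 * n))
    set Y := (2 * (k : ℝ) + 1) * (Real.pi * c / (2 * n))
    have e1 : (((j : ℤ) - k : ℤ) : ℝ) * Real.pi * c / n = X - Y := by
      simp only [X, Y]; push_cast; field_simp; ring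
    have e2 : (((j : ℤ) + k + 1 : ℤ) : ℝ) * Real.pi * c / n = X + Y := by
      simp only [X, Y]; push_cast; field_simp; ring
    rw [e1, e2, Real.cos_sub, Real.cos_add]; ring
  simp_rw [this]
  rw [Finset.sum_sub_distrib, ← Finset.mul_sum, ← Finset.mul_sum,
    cos_sum_zero n hn ((j : ℤ) + k + 1) (by omega) (by rw [abs_lt]; omega)]
  split_ifs with h
  · subst h; simp
  · rw [cos_sum_zero n hn ((j : ℤ) - k) (by omega) (by rw [abs_lt]; omega)]; simp

lemma parseval_cos (n : ℕ) (hn : 0 < n) (b : ℕ → ℝ) :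
    ∑ c ∈ Finset.range (2 * n), (∑ j ∈ Finset.range (n - 1),
      b j * Real.cos (2 * ((j : ℝ) + 1) * (Real.pi * c / (2 * n)))) ^ 2
      = n * ∑ j ∈ Finset.range (n - 1), b j ^ 2 := by
  have hn' : (n : ℝ) ≠ 0 := by positivity
  apply parseval_gen (Finset.range (n - 1)) (2 * n)
    (fun j c => Real.cos (2 * ((j : ℝ) + 1) * (Real.pi * c / (2 * n)))) b n
  intro j hj k hk
  simp only [Finset.mem_range] at hj hk
  have : ∀ c : ℕ, Real.cos (2 * ((j : ℝ) + 1) * (Real.pi * c / (2 * n))) *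
      Real.cos (2 * ((k : ℝ) + 1) * (Real.pi * c / (2 * n))) =
      (1 / 2) * Real.cos ((((j : ℤ) - k : ℤ) : ℝ) * Real.pi * c / n) +
      (1 / 2) * Real.cos ((((j : ℤ) + k + 2 : ℤ) : ℝ) * Real.pi * c / n) := by
    intro c
    set X := 2 * ((j : ℝ) + 1) * (Real.pi * c / (2 * n))
    set Y := 2 * ((k : ℝ) + 1) * (Real.pi * c / (2 * n))
    have e1 : (((j : ℤ) - k : ℤ) : ℝ) * Real.pi * c / n = X - Y := by
      simp only [X, Y]; push_cast; field_simp; ring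
    have e2 : (((j : ℤ) + k + 2 : ℤ) : ℝ) * Real.pi * c / n = X + Y := by
      simp only [X, Y]; push_cast; field_simp; ring
    rw [e1, e2, Real.cos_sub, Real.cos_add]; ring
  simp_rw [this]
  rw [Finset.sum_add_distrib, ← Finset.mul_sum, ← Finset.mul_sum,
    cos_sum_zero n hn ((j : ℤ) + k + 2) (by omega) (by rw [abs_lt]; omega)]
  split_ifs with h
  · subst h; simp
  · rw [cos_sum_zero n hn ((j : ℤ) - k) (by omega) (by rw [abs_lt]; omega)]; simp

/-- even periodic kernel -/
noncomputable def Hk (n : ℕ) (F : ℕ → ℝ) (c : ℤ) : ℝ :=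
  F 0 / 2 + ∑ j ∈ Finset.range (n - 1), F (j + 1) * Real.cos (2 * ((j : ℝ) + 1) * (Real.pi * c / (2 * n)))
    + F n / 2 * Real.cos (Real.pi * c)

lemma Hk_neg (n : ℕ) (F : ℕ → ℝ) (c : ℤ) : Hk n F (-c) = Hk n F c := by
  unfold Hk
  congr 1
  · congr 1
    refine Finset.sum_congr rfl fun j _ => ?_
    rw [← Real.cos_neg]; congr 2; push_cast; ring
  · rw [← Real.cos_neg]; congr 2; push_cast; ring

lemma Hk_per (n : ℕ) (hn : 0 < n) (F : ℕ → ℝ) (c : ℤ) : Hk n F (c + 2 * n) = Hk n F c := by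
  have hn' : (n : ℝ) ≠ 0 := by positivity
  unfold Hk
  congr 1
  · congr 1
    refine Finset.sum_congr rfl fun j _ => ?_
    have : 2 * ((j : ℝ) + 1) * (Real.pi * ((c + 2 * n : ℤ) : ℝ) / (2 * n)) =
      2 * ((j : ℝ) + 1) * (Real.pi * c / (2 * n)) + ((j + 1 : ℕ) : ℝ) * (2 * Real.pi) := by
      push_cast; field_simp
    rw [this, Real.cos_add_nat_mul_two_pi]
  · have : Real.pi * ((c + 2 * n : ℤ) : ℝ) = Real.pi * c + (n : ℝ) * (2 * Real.pi) := by
      push_cast; ring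
    rw [this, Real.cos_add_nat_mul_two_pi]

lemma Hk_sin (n : ℕ) (hn : 0 < n) (F : ℕ → ℝ) (c : ℕ) :
    2 * Real.sin (Real.pi * c / (2 * n)) * Hk n F c =
     ∑ j ∈ Finset.range n, (F j - F (j + 1)) * Real.sin ((2 * (j : ℝ) + 1) * (Real.pi * c / (2 * n))) := by
  have hn' : (n : ℝ) ≠ 0 := by positivity
  set θ := Real.pi * c / (2 * n) with hθ
  have key : ∀ N : ℕ, ∑ j ∈ Finset.range (N + 1), (F j - F (j + 1)) * Real.sin ((2 * (j : ℝ) + 1) * θ)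
    = 2 * Real.sin θ * (F 0 / 2 + ∑ j ∈ Finset.range N, F (j + 1) * Real.cos (2 * ((j : ℝ) + 1) * θ))
      - F (N + 1) * Real.sin ((2 * (N : ℝ) + 1) * θ) := by
    intro N
    induction N with
    | zero => simp; ring
    | succ N ih =>
      rw [Finset.sum_range_succ, ih, Finset.sum_range_succ]
      have e1 : (2 * ((N + 1 : ℕ) : ℝ) + 1) * θ = 2 * ((N : ℝ) + 1) * θ + θ := by push_cast; ring
      have e2 : (2 * (N : ℝ) + 1) * θ = 2 * ((N : ℝ) + 1) * θ - θ := by ring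
      rw [e1, e2, Real.sin_add, Real.sin_sub]; ring
  obtain ⟨N, rfl⟩ : ∃ N, n = N + 1 := ⟨n - 1, by omega⟩
  rw [key N]
  unfold Hk
  simp only [Nat.add_sub_cancel, Int.cast_natCast]
  have e3 : (2 * (N : ℝ) + 1) * θ = Real.pi * c - θ := by
    rw [hθ]; push_cast at hn' ⊢; field_simp; ring
  have hs : Real.sin (Real.pi * c) = 0 := by rw [mul_comm]; exact Real.sin_nat_mul_pi c
  rw [e3, Real.sin_sub, hs, ← hθ]; ring

lemma Hk_sq_sum (n : ℕ) (hn : 0 < n) (F : ℕ → ℝ) :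
    ∑ c ∈ Finset.range (2 * n), Hk n F (c : ℤ) ^ 2 ≤ 3 * n * ∑ j ∈ Finset.range (n + 1), F j ^ 2 := by
  have hb : ∀ c ∈ Finset.range (2 * n), Hk n F (c : ℤ) ^ 2 ≤ 3 * (F 0 ^ 2 / 4 + F n ^ 2 / 4) +
     3 * (∑ j ∈ Finset.range (n - 1), F (j + 1) * Real.cos (2 * ((j : ℝ) + 1) * (Real.pi * c / (2 * n)))) ^ 2 := by
    intro c _
    unfold Hk
    simp only [Int.cast_natCast]
    set S := ∑ j ∈ Finset.range (n - 1), F (j + 1) * Real.cos (2 * ((j : ℝ) + 1) * (Real.pi * c / (2 * n)))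
    have h1 : (F n / 2 * Real.cos (Real.pi * c)) ^ 2 ≤ F n ^ 2 / 4 := by
      have := Real.cos_sq_le_one (Real.pi * c)
      nlinarith [sq_nonneg (F n)]
    set U := F n / 2 * Real.cos (Real.pi * c)
    nlinarith [sq_nonneg (F 0 / 2 - S), sq_nonneg (F 0 / 2 - U), sq_nonneg (S - U)]
  refine (Finset.sum_le_sum hb).trans ?_
  rw [Finset.sum_add_distrib, ← Finset.mul_sum, ← Finset.mul_sum, parseval_cos n hn (fun j => F (j + 1))]
  have hs : ∑ j ∈ Finset.range (n + 1), F j ^ 2 =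
      F 0 ^ 2 + ∑ j ∈ Finset.range (n - 1), F (j + 1) ^ 2 + F n ^ 2 := by
    obtain ⟨N, rfl⟩ : ∃ N, n = N + 1 := ⟨n - 1, by omega⟩
    rw [Finset.sum_range_succ, Finset.sum_range_succ']
    simp only [Nat.add_sub_cancel]; ring
  rw [hs]
  simp only [Finset.sum_const, Finset.card_range, nsmul_eq_mul]
  push_cast
  have : (0 : ℝ) < n := by positivity
  nlinarith [mul_nonneg this.le (sq_nonneg (F 0)), mul_nonneg this.le (sq_nonneg (F n))]

lemma sin_lb (n : ℕ) (hn : 0 < n) (c : ℝ) (h0 : 0 ≤ c) (h1 : c ≤ n) :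
    c / n ≤ Real.sin (Real.pi * c / (2 * n)) := by
  have hn' : (0 : ℝ) < n := by positivity
  have := Real.mul_le_sin (x := Real.pi * c / (2 * n)) (by positivity) (by
    rw [div_le_div_iff₀ (by positivity) (by positivity)]
    nlinarith [Real.pi_pos])
  refine le_trans (le_of_eq ?_) this
  field_simp

lemma weight_sum (n : ℕ) (hn : 0 < n) (σ : ℝ) (hσ : 1 / (n : ℝ) ≤ σ) :
    ∑ c ∈ Finset.range (2 * n), 1 / (1 + (2 * Real.sin (Real.pi * c / (2 * n)) / σ) ^ 2) ≤ 3 * n * σ := by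
  have hn' : (0 : ℝ) < n := by positivity
  have hσ0 : 0 < σ := lt_of_lt_of_le (by positivity) hσ
  have hnσ : 1 ≤ n * σ := by rw [div_le_iff₀ hn'] at hσ; linarith
  set L : ℝ := n * σ / 2 with hL
  have hL0 : 0 < L := by positivity
  have hw : ∀ c : ℝ, 0 ≤ c → c ≤ n → 1 / (1 + (2 * Real.sin (Real.pi * c / (2 * n)) / σ) ^ 2)
      ≤ 1 / (1 + (c / L) ^ 2) := by
    intro c h0 h1
    apply one_div_le_one_div_of_le (by positivity)
    have := sin_lb n hn c h0 h1
    have e : c / L = 2 * (c / n) / σ := by rw [hL]; field_simp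
    rw [e]
    gcongr
  rw [two_mul, Finset.sum_range_add]
  have hA : ∑ c ∈ Finset.range n, 1 / (1 + (2 * Real.sin (Real.pi * c / (2 * n)) / σ) ^ 2) ≤ 1 + 2 * L := by
    obtain ⟨N, rfl⟩ : ∃ N, n = N + 1 := ⟨n - 1, by omega⟩
    rw [Finset.sum_range_succ', add_comm]
    have h1 := sum_inv_sq L hL0 N
    refine add_le_add (by simp) (le_trans (Finset.sum_le_sum ?_) h1)
    intro i hi
    have := Finset.mem_range.mp hi
    have h := hw ((i + 1 : ℕ) : ℝ) (by positivity) (by exact_mod_cast (by omega))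
    push_cast at h ⊢
    exact h
  have hB : ∑ c ∈ Finset.range n, 1 / (1 + (2 * Real.sin (Real.pi * (n + c : ℕ) / (2 * n)) / σ) ^ 2) ≤ 2 * L := by
    rw [← Finset.sum_range_reflect]
    refine le_trans (Finset.sum_le_sum ?_) (sum_inv_sq L hL0 n)
    intro i hi
    have hi := Finset.mem_range.mp hi
    have h := hw ((i + 1 : ℕ) : ℝ) (by positivity) (by exact_mod_cast (by omega))
    have e : Real.sin (Real.pi * (n + (n - 1 - i) : ℕ) / (2 * n)) = Real.sin (Real.pi * (i + 1 : ℕ) / (2 * n)) := by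
      rw [← Real.sin_pi_sub]
      congr 1
      have : ((n + (n - 1 - i) : ℕ) : ℝ) = 2 * n - (i + 1) := by
        have : n + (n - 1 - i) + (i + 1) = 2 * n := by omega
        have h2 : ((n + (n - 1 - i) : ℕ) : ℝ) + (i + 1) = 2 * n := by exact_mod_cast this
        linarith
      rw [this]; push_cast; field_simp; ring
    rw [e]
    push_cast at h ⊢
    exact h
  have : 1 + 2 * L + 2 * L ≤ 3 * n * σ := by rw [hL]; nlinarith
  linarith

lemma Hk_L1 (n : ℕ) (hn : 0 < n) (F : ℕ → ℝ) (σ A : ℝ) (hσ : 1 / (n : ℝ) ≤ σ)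
    (h1 : ∑ j ∈ Finset.range (n + 1), F j ^ 2 ≤ A / σ)
    (h2 : ∑ j ∈ Finset.range n, (F j - F (j + 1)) ^ 2 ≤ A * σ) :
    (∑ c ∈ Finset.range (2 * n), |Hk n F (c : ℤ)|) ^ 2 ≤ 12 * n ^ 2 * A := by
  have hn' : (0 : ℝ) < n := by positivity
  have hσ0 : 0 < σ := lt_of_lt_of_le (by positivity) hσ
  set w : ℕ → ℝ := fun c => 1 + (2 * Real.sin (Real.pi * c / (2 * n)) / σ) ^ 2 with hw
  have hw0 : ∀ c, 0 < w c := fun c => by simp only [hw]; positivity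
  have hne : (Finset.range (2 * n)).Nonempty := by simp; omega
  have h := Finset.sq_sum_div_le_sum_sq_div (Finset.range (2 * n)) (fun c : ℕ => |Hk n F (c : ℤ)|)
    (g := fun c => 1 / w c) (fun c _ => by have := hw0 c; positivity)
  have hpos : 0 < ∑ c ∈ Finset.range (2 * n), 1 / w c :=
    Finset.sum_pos (fun c _ => by have := hw0 c; positivity) hne
  rw [div_le_iff₀ hpos] at h
  have hws : ∑ c ∈ Finset.range (2 * n), 1 / w c ≤ 3 * n * σ := weight_sum n hn σ hσ
  have hE : ∑ c ∈ Finset.range (2 * n), |Hk n F (c : ℤ)| ^ 2 / (1 / w c) ≤ 4 * n * A / σ := by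
    have e : ∀ c ∈ Finset.range (2 * n), |Hk n F (c : ℤ)| ^ 2 / (1 / w c) =
        Hk n F (c : ℤ) ^ 2 + (1 / σ ^ 2) *
        (∑ j ∈ Finset.range n, (F j - F (j + 1)) * Real.sin ((2 * (j : ℝ) + 1) * (Real.pi * c / (2 * n)))) ^ 2 := by
      intro c _
      rw [← Hk_sin n hn F c, sq_abs]
      simp only [hw]
      have := hw0 c
      field_simp
    rw [Finset.sum_congr rfl e, Finset.sum_add_distrib, ← Finset.mul_sum,
      parseval_sin n hn (fun j => F j - F (j + 1))]
    have h3 := Hk_sq_sum n hn F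
    have h4 : 3 * n * ∑ j ∈ Finset.range (n + 1), F j ^ 2 ≤ 3 * n * (A / σ) := by gcongr
    have h5 : 1 / σ ^ 2 * (n * ∑ j ∈ Finset.range n, (F j - F (j + 1)) ^ 2) ≤ 1 / σ ^ 2 * (n * (A * σ)) := by
      gcongr
    have h6 : 1 / σ ^ 2 * (n * (A * σ)) = n * (A / σ) := by field_simp
    have h7 : 4 * n * A / σ = 3 * n * (A / σ) + n * (A / σ) := by ring
    linarith
  have hA : 0 ≤ A := by
    have : 0 ≤ A / σ := le_trans (Finset.sum_nonneg fun _ _ => sq_nonneg _) h1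
    by_contra hc
    push Not at hc
    have := div_neg_of_neg_of_pos hc hσ0
    linarith
  calc _ ≤ _ := h
    _ ≤ (4 * n * A / σ) * (3 * n * σ) := by gcongr
    _ = _ := by field_simp; ring

/-- kernel at grid points -/
noncomputable def fgrid (n : ℕ) (F : ℕ → ℝ) (a b : ℤ) : ℝ :=
  ∑ j ∈ Finset.Icc 1 (n - 1), F j * phiF j ((a : ℝ) / n) * phiF j ((b : ℝ) / n)

lemma sum_Icc_one {β : Type*} [AddCommMonoid β] (N : ℕ) (f : ℕ → β) :
    ∑ j ∈ Finset.Icc 1 N, f j = ∑ j ∈ Finset.range N, f (j + 1) := by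
  rw [Finset.range_eq_Ico, Finset.sum_Ico_add' f 0 N 1]
  congr 1

lemma fgrid_eq (n : ℕ) (hn : 0 < n) (F : ℕ → ℝ) (a b : ℤ) :
    fgrid n F a b = Hk n F (a - b) - Hk n F (a + b) := by
  have hn' : (n : ℝ) ≠ 0 := by positivity
  unfold fgrid Hk
  have e : Real.cos (Real.pi * ((a - b : ℤ) : ℝ)) = Real.cos (Real.pi * ((a + b : ℤ) : ℝ)) := by
    have : Real.pi * ((a + b : ℤ) : ℝ) = Real.pi * ((a - b : ℤ) : ℝ) + (b : ℝ) * (2 * Real.pi) := by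
      push_cast; ring
    rw [this, Real.cos_add_int_mul_two_pi]
  rw [e, sum_Icc_one, add_sub_add_right_eq_sub, add_sub_add_left_eq_sub, ← Finset.sum_sub_distrib]
  refine Finset.sum_congr rfl fun j _ => ?_
  unfold phiF
  set X := ((j + 1 : ℕ) : ℝ) * Real.pi * (a / n)
  set Y := ((j + 1 : ℕ) : ℝ) * Real.pi * (b / n)
  have e1 : 2 * ((j : ℝ) + 1) * (Real.pi * ((a - b : ℤ) : ℝ) / (2 * n)) = X - Y := by
    simp only [X, Y]; push_cast; field_simp
  have e2 : 2 * ((j : ℝ) + 1) * (Real.pi * ((a + b : ℤ) : ℝ) / (2 * n)) = X + Y := by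
    simp only [X, Y]; push_cast; field_simp
  rw [e1, e2, Real.cos_sub, Real.cos_add]
  have h2 : Real.sqrt 2 * Real.sqrt 2 = 2 := Real.mul_self_sqrt (by norm_num)
  linear_combination (F (j + 1) * Real.sin X * Real.sin Y) * h2

lemma per_sum (M : ℕ) (h : ℤ → ℝ) (hp : ∀ c, h (c + M) = h c) (a : ℤ) :
    ∑ b ∈ Finset.range M, h (b + a) = ∑ b ∈ Finset.range M, h b := by
  have step : ∀ a : ℤ, ∑ b ∈ Finset.range M, h (b + (a + 1)) = ∑ b ∈ Finset.range M, h (b + a) := by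
    intro a
    have h1 := Finset.sum_range_succ (fun b : ℕ => h (b + a)) M
    have h2 := Finset.sum_range_succ' (fun b : ℕ => h (b + a)) M
    have h3 := hp a
    have h4 : ∑ b ∈ Finset.range M, h (b + (a + 1)) = ∑ b ∈ Finset.range M, h (((b + 1 : ℕ) : ℤ) + a) := by
      refine Finset.sum_congr rfl fun b _ => ?_
      congr 1; push_cast; ring
    rw [h4]
    rw [add_comm a] at h3
    simp only [Nat.cast_zero, zero_add] at h2
    linarith
  induction a using Int.induction_on with
  | zero => simp
  | succ i ih => rw [step, ih]
  | pred i ih => rw [← step]; simpa using ih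

lemma fgrid_L1 (n : ℕ) (hn : 0 < n) (F : ℕ → ℝ) (a : ℤ) :
    ∑ b ∈ Finset.range n, |fgrid n F a b| ≤ 2 * ∑ c ∈ Finset.range (2 * n), |Hk n F (c : ℤ)| := by
  have key : ∀ a : ℤ, ∑ b ∈ Finset.range n, |Hk n F (b + a)| ≤ ∑ c ∈ Finset.range (2 * n), |Hk n F (c : ℤ)| := by
    intro a
    rw [← per_sum (2 * n) (fun c => |Hk n F c|) (fun c => by
      have := Hk_per n hn F c
      push_cast; rw [this]) a]
    refine Finset.sum_le_sum_of_subset_of_nonneg ?_ (fun _ _ _ => abs_nonneg _)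
    intro x; simp; omega
  have h1 := key a
  have h2 := key (-a)
  calc ∑ b ∈ Finset.range n, |fgrid n F a b| ≤ ∑ b ∈ Finset.range n, (|Hk n F (b + -a)| + |Hk n F (b + a)|) := by
        refine Finset.sum_le_sum fun b _ => ?_
        rw [fgrid_eq n hn, ← Hk_neg n F (a - b), neg_sub, add_comm a, ← sub_eq_add_neg]
        exact abs_sub _ _
    _ ≤ _ := by rw [Finset.sum_add_distrib]; linarith

lemma exp_sum (a : ℝ) (ha : 1 ≤ a) (τ : ℝ) (hτ : 0 < τ) (N : ℕ) :
    ∑ k ∈ Finset.range N, Real.exp (-(a * ((k : ℝ) + 1) ^ 2 * τ)) ≤ 2 / Real.sqrt τ := by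
  have hs : 0 < Real.sqrt τ := Real.sqrt_pos.mpr hτ
  have h := sum_inv_sq (1 / Real.sqrt τ) (by positivity) N
  rw [mul_one_div] at h
  refine le_trans (Finset.sum_le_sum fun k _ => ?_) h
  have e : (((k : ℝ) + 1) / (1 / Real.sqrt τ)) ^ 2 = ((k : ℝ) + 1) ^ 2 * τ := by
    rw [div_div_eq_mul_div, div_one, mul_pow, Real.sq_sqrt hτ.le]
  rw [e, Real.exp_neg, ← one_div]
  apply one_div_le_one_div_of_le (by positivity)
  have h1 : ((k : ℝ) + 1) ^ 2 * τ ≤ a * ((k : ℝ) + 1) ^ 2 * τ := by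
    have : 0 ≤ ((k : ℝ) + 1) ^ 2 * τ := by positivity
    nlinarith
  linarith [Real.add_one_le_exp (a * ((k : ℝ) + 1) ^ 2 * τ)]

/-- general kernel -/
noncomputable def fF (n : ℕ) (F : ℕ → ℝ) (x z : ℝ) : ℝ :=
  ∑ j ∈ Finset.Icc 1 (n - 1), F j * phiLin n j x * phiF j (kappa n z)

lemma fF_eq (n : ℕ) (F : ℕ → ℝ) (x z : ℝ) :
    fF n F x z = (1 - Int.fract (n * x)) * fgrid n F ⌊(n : ℝ) * x⌋ ⌊(n : ℝ) * z⌋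
      + Int.fract (n * x) * fgrid n F (⌊(n : ℝ) * x⌋ + 1) ⌊(n : ℝ) * z⌋ := by
  unfold fF fgrid
  rw [Finset.mul_sum, Finset.mul_sum, ← Finset.sum_add_distrib]
  refine Finset.sum_congr rfl fun j _ => ?_
  unfold phiLin kappa Int.fract
  push_cast
  ring

/-- hypotheses on the multiplier -/
def MultHyp (n : ℕ) (τ ε : ℝ) (F : ℕ → ℝ) : Prop :=
  (∀ k : ℕ, k ≤ n → |F k| ≤ ε * Real.exp (-(2 * (k : ℝ) ^ 2 * τ))) ∧
  (∀ k : ℕ, k < n → |F k - F (k + 1)| ≤ ε * (20 * τ * (2 * k + 1) * Real.exp (-(2 * (k : ℝ) ^ 2 * τ))))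

lemma phiF_abs_le (j : ℕ) (x : ℝ) : |phiF j x| ≤ Real.sqrt 2 := by
  unfold phiF
  rw [abs_mul, abs_of_nonneg (Real.sqrt_nonneg 2)]
  have := Real.abs_sin_le_one (j * Real.pi * x)
  nlinarith [Real.sqrt_nonneg 2]

lemma fgrid_sup (n : ℕ) (τ ε : ℝ) (hτ : 0 < τ) (hε : 0 ≤ ε) (F : ℕ → ℝ)
    (hF : MultHyp n τ ε F) (a b : ℤ) : |fgrid n F a b| ≤ 4 * ε / Real.sqrt τ := by
  unfold fgrid
  rw [sum_Icc_one]
  refine (Finset.abs_sum_le_sum_abs _ _).trans ?_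
  calc _ ≤ ∑ j ∈ Finset.range (n - 1), 2 * ε * Real.exp (-(2 * ((j : ℝ) + 1) ^ 2 * τ)) := by
        refine Finset.sum_le_sum fun j hj => ?_
        have := Finset.mem_range.mp hj
        have h1 := hF.1 (j + 1) (by omega)
        push_cast at h1
        rw [abs_mul, abs_mul]
        have h2 := phiF_abs_le (j + 1) (a / n)
        have h3 := phiF_abs_le (j + 1) (b / n)
        have h4 : |phiF (j + 1) (a / n)| * |phiF (j + 1) (b / n)| ≤ 2 := by
          calc _ ≤ Real.sqrt 2 * Real.sqrt 2 := by gcongr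
            _ = 2 := Real.mul_self_sqrt (by norm_num)
        calc _ = |F (j + 1)| * (|phiF (j + 1) (a / n)| * |phiF (j + 1) (b / n)|) := by ring
          _ ≤ (ε * Real.exp (-(2 * ((j : ℝ) + 1) ^ 2 * τ))) * 2 := by gcongr
          _ = _ := by ring
    _ ≤ 2 * ε * (2 / Real.sqrt τ) := by
        rw [← Finset.mul_sum]
        gcongr
        exact exp_sum 2 (by norm_num) τ hτ _
    _ = _ := by ring

lemma fF_sup (n : ℕ) (τ ε : ℝ) (hτ : 0 < τ) (hε : 0 ≤ ε) (F : ℕ → ℝ)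
    (hF : MultHyp n τ ε F) (x z : ℝ) : |fF n F x z| ≤ 4 * ε / Real.sqrt τ := by
  rw [fF_eq]
  have h0 := Int.fract_nonneg ((n : ℝ) * x)
  have h1 := (Int.fract_lt_one ((n : ℝ) * x)).le
  have h2 := fgrid_sup n τ ε hτ hε F hF ⌊(n : ℝ) * x⌋ ⌊(n : ℝ) * z⌋
  have h3 := fgrid_sup n τ ε hτ hε F hF (⌊(n : ℝ) * x⌋ + 1) ⌊(n : ℝ) * z⌋
  refine (abs_add_le _ _).trans ?_
  rw [abs_mul, abs_mul, abs_of_nonneg h0, abs_of_nonneg (sub_nonneg.mpr h1)]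
  nlinarith

/-- constant -/
noncomputable def cA (T : ℝ) : ℝ := 400 * (4 + 2 * T) * (Real.sqrt T + 2)

lemma Hk_bound (T : ℝ) (hT : 0 < T) (n : ℕ) (hn : 0 < n) (τ ε : ℝ) (hτ : 0 < τ) (hτT : τ ≤ T) (hε : 0 ≤ ε)
    (F : ℕ → ℝ) (hF : MultHyp n τ ε F) :
    ∑ c ∈ Finset.range (2 * n), |Hk n F (c : ℤ)| ≤ n * ε * Real.sqrt (12 * cA T) := by
  have hn' : (0 : ℝ) < n := by positivity
  have hn1 : (1 : ℝ) ≤ n := by exact_mod_cast hn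
  have hs : 0 < Real.sqrt τ := Real.sqrt_pos.mpr hτ
  have hsT : Real.sqrt τ ≤ Real.sqrt T := Real.sqrt_le_sqrt hτT
  have hss : Real.sqrt τ * Real.sqrt τ = τ := Real.mul_self_sqrt hτ.le
  have hcA : 0 ≤ cA T := by unfold cA; positivity
  set σ := max (Real.sqrt τ) (1 / (n : ℝ)) with hσ
  have hσ0 : 0 < σ := lt_of_lt_of_le hs (le_max_left _ _)
  have h1a : ∑ j ∈ Finset.range (n + 1), F j ^ 2 ≤ ε ^ 2 * ((Real.sqrt T + 2) / Real.sqrt τ) := by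
    calc _ ≤ ∑ j ∈ Finset.range (n + 1), ε ^ 2 * Real.exp (-(4 * (j : ℝ) ^ 2 * τ)) := by
          refine Finset.sum_le_sum fun j hj => ?_
          have := Finset.mem_range.mp hj
          have h := hF.1 j (by omega)
          rw [← sq_abs]
          calc _ ≤ (ε * Real.exp (-(2 * (j : ℝ) ^ 2 * τ))) ^ 2 := by gcongr
            _ = _ := by
              rw [mul_pow, ← Real.exp_nat_mul]; congr 2; push_cast; ring
      _ = ε ^ 2 * (∑ j ∈ Finset.range n, Real.exp (-(4 * ((j : ℝ) + 1) ^ 2 * τ)) + 1) := by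
          rw [← Finset.mul_sum, Finset.sum_range_succ']; simp
      _ ≤ ε ^ 2 * (2 / Real.sqrt τ + 1) := by
          gcongr; exact exp_sum 4 (by norm_num) τ hτ _
      _ ≤ _ := by
          gcongr
          rw [add_div, add_comm]
          gcongr
          rwa [le_div_iff₀ hs, one_mul]
  have h1b : ∑ j ∈ Finset.range (n + 1), F j ^ 2 ≤ ε ^ 2 * (2 * n) := by
    calc _ ≤ ∑ j ∈ Finset.range (n + 1), ε ^ 2 := by
          refine Finset.sum_le_sum fun j hj => ?_
          have := Finset.mem_range.mp hj
          have h := hF.1 j (by omega)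
          rw [← sq_abs]
          have h2 : Real.exp (-(2 * (j : ℝ) ^ 2 * τ)) ≤ 1 := Real.exp_le_one_iff.mpr (by
            have : 0 ≤ 2 * (j : ℝ) ^ 2 * τ := by positivity
            linarith)
          gcongr
          nlinarith
      _ ≤ _ := by
          simp only [Finset.sum_const, Finset.card_range, nsmul_eq_mul]
          push_cast
          nlinarith [sq_nonneg ε]
  have hA2 : Real.sqrt T + 2 ≤ cA T := by
    unfold cA
    have : 0 ≤ Real.sqrt T := Real.sqrt_nonneg T
    nlinarith
  have h1 : ∑ j ∈ Finset.range (n + 1), F j ^ 2 ≤ (ε ^ 2 * cA T) / σ := by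
    rcases max_cases (Real.sqrt τ) (1 / (n : ℝ)) with ⟨h, _⟩ | ⟨h, _⟩
    · rw [hσ, h]
      refine h1a.trans ?_
      rw [mul_div_assoc]
      gcongr
    · rw [hσ, h]
      refine h1b.trans ?_
      rw [mul_div_assoc]
      gcongr
      rw [div_div_eq_mul_div, div_one]
      gcongr
      have : 0 ≤ Real.sqrt T := Real.sqrt_nonneg T
      linarith
  have h2 : ∑ j ∈ Finset.range n, (F j - F (j + 1)) ^ 2 ≤ (ε ^ 2 * cA T) * σ := by
    calc _ ≤ ∑ j ∈ Finset.range n, (400 * ε ^ 2 * (4 * τ + 2 * τ ^ 2)) * Real.exp (-(2 * (j : ℝ) ^ 2 * τ)) := by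
          refine Finset.sum_le_sum fun j hj => ?_
          have h := hF.2 j (Finset.mem_range.mp hj)
          rw [← sq_abs]
          set E := Real.exp (-(2 * (j : ℝ) ^ 2 * τ)) with hE
          have hE0 : 0 < E := Real.exp_pos _
          have hx : 2 * (j : ℝ) ^ 2 * τ * E ≤ 1 := by
            rw [hE, Real.exp_neg, ← div_eq_mul_inv, div_le_one (Real.exp_pos _)]
            linarith [Real.add_one_le_exp (2 * (j : ℝ) ^ 2 * τ)]
          have hE1 : E ≤ 1 := Real.exp_le_one_iff.mpr (by
            have : 0 ≤ 2 * (j : ℝ) ^ 2 * τ := by positivity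
            linarith)
          calc _ ≤ (ε * (20 * τ * (2 * j + 1) * E)) ^ 2 := by gcongr
            _ = 400 * ε ^ 2 * τ ^ 2 * (2 * j + 1) ^ 2 * E * E := by ring
            _ ≤ 400 * ε ^ 2 * τ ^ 2 * (8 * j ^ 2 + 2) * E * E := by
                gcongr
                nlinarith [sq_nonneg (2 * (j : ℝ) - 1)]
            _ = 400 * ε ^ 2 * (4 * τ * (2 * (j : ℝ) ^ 2 * τ * E) + 2 * τ ^ 2 * E) * E := by ring
            _ ≤ 400 * ε ^ 2 * (4 * τ * 1 + 2 * τ ^ 2 * 1) * E := by gcongr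
            _ = _ := by ring
      _ ≤ (400 * ε ^ 2 * (4 * τ + 2 * τ ^ 2)) * (2 / Real.sqrt τ + 1) := by
          rw [← Finset.mul_sum]
          gcongr
          obtain ⟨N, rfl⟩ : ∃ N, n = N + 1 := ⟨n - 1, by omega⟩
          rw [Finset.sum_range_succ']
          have := exp_sum 2 (by norm_num) τ hτ N
          push_cast
          norm_num
          exact this
      _ = ε ^ 2 * (400 * (4 + 2 * τ) * (Real.sqrt τ + 2)) * Real.sqrt τ := by
          have e : 4 * τ + 2 * τ ^ 2 = Real.sqrt τ * Real.sqrt τ * (4 + 2 * τ) := by rw [hss]; ring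
          rw [e]; field_simp; ring
      _ ≤ _ := by
          unfold cA
          gcongr
          exact le_max_left _ _
  have h := Hk_L1 n hn F σ (ε ^ 2 * cA T) (le_max_right _ _) h1 h2
  have h' : 12 * (n : ℝ) ^ 2 * (ε ^ 2 * cA T) = (n * ε * Real.sqrt (12 * cA T)) ^ 2 := by
    rw [mul_pow, Real.sq_sqrt (by positivity)]; ring
  rw [h'] at h
  exact (pow_le_pow_iff_left₀ (Finset.sum_nonneg fun _ _ => abs_nonneg _) (by positivity) (by norm_num)).mp h

lemma lint_step (n : ℕ) (hn : 0 < n) (g : ℤ → ENNReal) :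
    ∫⁻ z in Set.Icc (0 : ℝ) 1, g ⌊(n : ℝ) * z⌋ = ∑ b ∈ Finset.range n, g b * ENNReal.ofReal (1 / n) := by
  have hn' : (0 : ℝ) < n := by positivity
  have key : ∀ N : ℕ, ∫⁻ z in Set.Ico (0 : ℝ) (N / n), g ⌊(n : ℝ) * z⌋
      = ∑ b ∈ Finset.range N, g b * ENNReal.ofReal (1 / n) := by
    intro N
    induction N with
    | zero => simp
    | succ N ih =>
      have hle : (N : ℝ) / n ≤ ((N + 1 : ℕ) : ℝ) / n := by gcongr; omega
      rw [← Set.Ico_union_Ico_eq_Ico (b := (N : ℝ) / n) (by positivity) hle,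
        lintegral_union measurableSet_Ico (by
          rw [Set.disjoint_left]; rintro z ⟨_, h1⟩ ⟨h2, _⟩; linarith), ih, Finset.sum_range_succ]
      congr 1
      have : ∫⁻ z in Set.Ico ((N : ℝ) / n) (((N + 1 : ℕ) : ℝ) / n), g ⌊(n : ℝ) * z⌋ =
         ∫⁻ z in Set.Ico ((N : ℝ) / n) (((N + 1 : ℕ) : ℝ) / n), g (N : ℤ) := by
        refine setLIntegral_congr_fun measurableSet_Ico fun z hz => ?_
        have : ⌊(n : ℝ) * z⌋ = (N : ℤ) := by
          rw [Int.floor_eq_iff]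
          obtain ⟨h1, h2⟩ := hz
          rw [div_le_iff₀ hn'] at h1
          rw [lt_div_iff₀ hn'] at h2
          push_cast at h2 ⊢
          constructor <;> linarith
        simp only [this]
      rw [this, setLIntegral_const, Real.volume_Ico]
      congr 2
      push_cast; field_simp; ring
  have h := key n
  rw [div_self hn'.ne'] at h
  rw [← h]
  exact setLIntegral_congr Ico_ae_eq_Icc.symm

lemma fF_L1 (T : ℝ) (hT : 0 < T) (n : ℕ) (hn : 0 < n) (τ ε : ℝ) (hτ : 0 < τ) (hτT : τ ≤ T) (hε : 0 ≤ ε)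
    (F : ℕ → ℝ) (hF : MultHyp n τ ε F) (x : ℝ) :
    ∫⁻ z in Set.Icc (0 : ℝ) 1, ‖fF n F x z‖ₑ ≤ ENNReal.ofReal (2 * Real.sqrt (12 * cA T) * ε) := by
  have hn' : (0 : ℝ) < n := by positivity
  set θ := Int.fract ((n : ℝ) * x) with hθ
  set a := ⌊(n : ℝ) * x⌋ with ha
  have h0 : 0 ≤ θ := Int.fract_nonneg ((n : ℝ) * x)
  have h1 : 0 ≤ 1 - θ := sub_nonneg.mpr (Int.fract_lt_one ((n : ℝ) * x)).le
  set g : ℤ → ℝ := fun b => (1 - θ) * |fgrid n F a b| + θ * |fgrid n F (a + 1) b| with hg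
  have hg0 : ∀ b, 0 ≤ g b := fun b => by simp only [hg]; positivity
  calc _ ≤ ∫⁻ z in Set.Icc (0 : ℝ) 1, ENNReal.ofReal (g ⌊(n : ℝ) * z⌋) := by
        refine lintegral_mono fun z => ?_
        simp only
        rw [Real.enorm_eq_ofReal_abs]
        apply ENNReal.ofReal_le_ofReal
        rw [fF_eq]
        refine (abs_add_le _ _).trans ?_
        rw [abs_mul, abs_mul, abs_of_nonneg h0, abs_of_nonneg h1]
    _ = ∑ b ∈ Finset.range n, ENNReal.ofReal (g b) * ENNReal.ofReal (1 / n) :=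
        lint_step n hn (fun b => ENNReal.ofReal (g b))
    _ = ENNReal.ofReal (∑ b ∈ Finset.range n, g b * (1 / n)) := by
        rw [ENNReal.ofReal_sum_of_nonneg (fun (b : ℕ) _ => mul_nonneg (hg0 (b : ℤ)) (by positivity))]
        refine Finset.sum_congr rfl fun b _ => ?_
        rw [ENNReal.ofReal_mul (hg0 b)]
    _ ≤ _ := by
        apply ENNReal.ofReal_le_ofReal
        rw [← Finset.sum_mul]
        have hH := Hk_bound T hT n hn τ ε hτ hτT hε F hF
        have e1 := fgrid_L1 n hn F a
        have e2 := fgrid_L1 n hn F (a + 1)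
        have e3 : ∑ b ∈ Finset.range n, g b ≤ n * (2 * Real.sqrt (12 * cA T) * ε) := by
          simp only [hg]
          rw [Finset.sum_add_distrib, ← Finset.mul_sum, ← Finset.mul_sum]
          set S1 := ∑ b ∈ Finset.range n, |fgrid n F a b|
          set S2 := ∑ b ∈ Finset.range n, |fgrid n F (a + 1) b|
          have f1 : S1 ≤ n * (2 * Real.sqrt (12 * cA T) * ε) := by linarith
          have f2 : S2 ≤ n * (2 * Real.sqrt (12 * cA T) * ε) := by linarith
          nlinarith
        rw [mul_one_div, div_le_iff₀ hn']
        linarith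

lemma near_int (β R : ℝ) (hβ : β < 1) (hR : 0 < R) (y : ℝ) :
    ∫⁻ z, Set.indicator {z : ℝ | |y - z| < R} (fun z => ‖y - z‖ₑ ^ (-β)) z
      ≤ ENNReal.ofReal (2 * (R ^ (1 - β) / (1 - β))) := by
  have h0 : ∫⁻ z, Set.indicator {z : ℝ | |y - z| < R} (fun z => ‖y - z‖ₑ ^ (-β)) z =
      ∫⁻ u, Set.indicator {u : ℝ | |u| < R} (fun u => ‖u‖ₑ ^ (-β)) u := by
    rw [← lintegral_sub_left_eq_self (Set.indicator {u : ℝ | |u| < R} (fun u => ‖u‖ₑ ^ (-β))) y]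
    rfl
  rw [h0]
  set g : ℝ → ENNReal := Set.indicator (Set.Ioc 0 R) (fun u => ENNReal.ofReal (u ^ (-β))) with hg
  have hgm : Measurable g := by
    apply Measurable.indicator _ measurableSet_Ioc
    fun_prop
  have hgi : ∫⁻ u, g u = ENNReal.ofReal (R ^ (1 - β) / (1 - β)) := by
    rw [hg, lintegral_indicator measurableSet_Ioc, ← ofReal_integral_eq_lintegral_ofReal]
    · rw [← intervalIntegral.integral_of_le hR.le, integral_rpow (Or.inl (by linarith)),
        Real.zero_rpow (by linarith)]
      congr 1
      have : -β + 1 = 1 - β := by ring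
      rw [this]; ring
    · have := (intervalIntegral.intervalIntegrable_rpow' (a := 0) (b := R) (r := -β) (by linarith))
      rw [intervalIntegrable_iff_integrableOn_Ioc_of_le hR.le] at this
      exact this
    · filter_upwards [ae_restrict_mem measurableSet_Ioc] with u hu
      exact Real.rpow_nonneg hu.1.le _
  calc _ ≤ ∫⁻ u, (g u + g (-u)) := by
        apply lintegral_mono_ae
        have : ∀ᵐ u : ℝ, u ≠ 0 := by
          simp [ae_iff, measure_singleton]
        filter_upwards [this] with u hu
        by_cases huR : u ∈ {u : ℝ | |u| < R}
        · rw [Set.indicator_of_mem huR]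
          have hpos : 0 < |u| := abs_pos.mpr hu
          have e : ‖u‖ₑ ^ (-β) = ENNReal.ofReal (|u| ^ (-β)) := by
            rw [Real.enorm_eq_ofReal_abs, ENNReal.ofReal_rpow_of_pos hpos]
          rw [e]
          have huR' : |u| < R := huR
          rcases lt_or_gt_of_ne hu with h | h
          · have : g (-u) = ENNReal.ofReal (|u| ^ (-β)) := by
              rw [abs_of_neg h] at huR' ⊢
              rw [hg, Set.indicator_of_mem (show -u ∈ Set.Ioc 0 R from ⟨by linarith, huR'.le⟩)]
            rw [this]; exact le_add_self
          · have : g u = ENNReal.ofReal (|u| ^ (-β)) := by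
              rw [abs_of_pos h] at huR' ⊢
              rw [hg, Set.indicator_of_mem (show u ∈ Set.Ioc 0 R from ⟨by linarith, huR'.le⟩)]
            rw [this]; exact le_self_add
        · rw [Set.indicator_of_notMem huR]; exact zero_le
    _ = (∫⁻ u, g u) + ∫⁻ u, g (-u) := lintegral_add_left hgm _
    _ = (∫⁻ u, g u) + ∫⁻ u, g u := by
        congr 1
        have := lintegral_sub_left_eq_self g (0 : ℝ) (μ := volume)
        simpa using this
    _ = _ := by
        rw [hgi, ← ENNReal.ofReal_add (by have : 0 < 1 - β := by linarith
                                          positivity) (by have : 0 < 1 - β := by linarith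
                                                          positivity)]
        congr 1; ring

/-- weighted norm in one dimension -/
noncomputable def W1 (β y : ℝ) (f : ℝ → ℝ) : ENNReal :=
  ∫⁻ z in Set.Icc (0 : ℝ) 1, ‖f z‖ₑ * ‖y - z‖ₑ ^ (-β)

lemma W1_le (β : ℝ) (hβ0 : 0 ≤ β) (hβ : β < 1) (f : ℝ → ℝ) (M B R : ℝ) (hM : 0 ≤ M) (hB : 0 ≤ B) (hR : 0 < R)
    (hfm : Measurable f) (hf : ∀ z, |f z| ≤ M) (hL : ∫⁻ z in Set.Icc (0 : ℝ) 1, ‖f z‖ₑ ≤ ENNReal.ofReal B) (y : ℝ) :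
    W1 β y f ≤ ENNReal.ofReal (M * (2 * (R ^ (1 - β) / (1 - β))) + B * R ^ (-β)) := by
  have hβ' : 0 < 1 - β := by linarith
  unfold W1
  calc _ ≤ ∫⁻ z in Set.Icc (0 : ℝ) 1, (ENNReal.ofReal M * Set.indicator {z : ℝ | |y - z| < R} (fun z => ‖y - z‖ₑ ^ (-β)) z
        + ‖f z‖ₑ * ENNReal.ofReal (R ^ (-β))) := by
        refine lintegral_mono fun z => ?_
        simp only
        by_cases h : z ∈ {z : ℝ | |y - z| < R}
        · rw [Set.indicator_of_mem h]
          refine le_trans ?_ le_self_add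
          gcongr
          rw [Real.enorm_eq_ofReal_abs]
          exact ENNReal.ofReal_le_ofReal (hf z)
        · rw [Set.indicator_of_notMem h]
          refine le_trans ?_ le_add_self
          gcongr
          have h' : R ≤ |y - z| := not_lt.mp h
          have hpos : 0 < |y - z| := lt_of_lt_of_le hR h'
          rw [Real.enorm_eq_ofReal_abs, ENNReal.ofReal_rpow_of_pos hpos]
          exact ENNReal.ofReal_le_ofReal (Real.rpow_le_rpow_of_nonpos hR h' (by linarith))
    _ = (∫⁻ z in Set.Icc (0 : ℝ) 1, ENNReal.ofReal M * Set.indicator {z : ℝ | |y - z| < R} (fun z => ‖y - z‖ₑ ^ (-β)) z)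
        + (∫⁻ z in Set.Icc (0 : ℝ) 1, ‖f z‖ₑ) * ENNReal.ofReal (R ^ (-β)) := by
        rw [lintegral_add_right, lintegral_mul_const]
        · fun_prop
        · fun_prop
    _ ≤ ENNReal.ofReal M * ENNReal.ofReal (2 * (R ^ (1 - β) / (1 - β))) + ENNReal.ofReal B * ENNReal.ofReal (R ^ (-β)) := by
        gcongr
        rw [lintegral_const_mul' _ _ ENNReal.ofReal_ne_top]
        gcongr
        exact (setLIntegral_le_lintegral _ _).trans (near_int β R hβ hR y)
    _ = _ := by
        rw [← ENNReal.ofReal_mul hM, ← ENNReal.ofReal_mul hB, ← ENNReal.ofReal_add]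
        all_goals positivity

lemma kappa_meas (n : ℕ) : Measurable (kappa n) := by unfold kappa; fun_prop
lemma phiF_meas (j : ℕ) : Measurable (phiF j) := by unfold phiF; fun_prop

lemma fF_meas (n : ℕ) (F : ℕ → ℝ) (x : ℝ) : Measurable (fF n F x) := by
  unfold fF
  refine Finset.measurable_fun_sum _ fun j _ => ?_
  exact ((phiF_meas j).comp (kappa_meas n)).const_mul _

lemma oneD_core (T : ℝ) (hT : 0 < T) (β : ℝ) (hβ0 : 0 ≤ β) (hβ : β < 1) :
    ∃ C : ℝ, 0 < C ∧ ∀ n : ℕ, 0 < n → ∀ τ ε : ℝ, 0 < τ → τ ≤ T → 0 ≤ ε → ∀ F : ℕ → ℝ, MultHyp n τ ε F →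
      ∀ x y : ℝ, W1 β y (fF n F x) ≤ ENNReal.ofReal (C * ε * τ ^ (-(β / 2))) := by
  have hβ' : 0 < 1 - β := by linarith
  refine ⟨8 / (1 - β) + 2 * Real.sqrt (12 * cA T), by positivity, ?_⟩
  intro n hn τ ε hτ hτT hε F hF x y
  have hs : 0 < Real.sqrt τ := Real.sqrt_pos.mpr hτ
  refine (W1_le β hβ0 hβ (fF n F x) (4 * ε / Real.sqrt τ) (2 * Real.sqrt (12 * cA T) * ε) (Real.sqrt τ)
    (by positivity) (by positivity) hs (fF_meas n F x) (fF_sup n τ ε hτ hε F hF x)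
    (fF_L1 T hT n hn τ ε hτ hτT hε F hF x) y).trans ?_
  apply ENNReal.ofReal_le_ofReal
  apply le_of_eq
  have e1 : Real.sqrt τ ^ (-β) = τ ^ (-(β / 2)) := by
    rw [Real.sqrt_eq_rpow, ← Real.rpow_mul hτ.le]; congr 1; ring
  have e2 : Real.sqrt τ ^ (1 - β) = Real.sqrt τ * τ ^ (-(β / 2)) := by
    rw [sub_eq_add_neg, Real.rpow_add hs, Real.rpow_one, e1]
  rw [e1, e2]
  field_simp
  ring

lemma lamn_ub (n k : ℕ) (hn : 0 < n) (hk : k ≤ n) : 4 * (k : ℝ) ^ 2 ≤ -lamn n k := by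
  have hn' : (0 : ℝ) < n := by positivity
  have h := sin_lb n hn k (by positivity) (by exact_mod_cast hk)
  rw [mul_comm Real.pi] at h
  unfold lamn
  have h2 : (k : ℝ) ≤ n * Real.sin (k * Real.pi / (2 * n)) := by
    rw [div_le_iff₀ hn'] at h; linarith
  have h3 : (k : ℝ) ^ 2 ≤ (n * Real.sin (k * Real.pi / (2 * n))) ^ 2 := by gcongr
  nlinarith

lemma lamn_diff (n k : ℕ) (hn : 0 < n) (hk : k < n) :
    -lamn n k ≤ -lamn n (k + 1) ∧ -lamn n (k + 1) - -lamn n k ≤ Real.pi ^ 2 * (2 * k + 1) := by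
  have hn' : (0 : ℝ) < n := by positivity
  have hkn : (k : ℝ) + 1 ≤ n := by exact_mod_cast hk
  have hpi := Real.pi_pos
  set A := ((k + 1 : ℕ) : ℝ) * Real.pi / (2 * n) with hA
  set B := (k : ℝ) * Real.pi / (2 * n) with hB
  have e : Real.sin A ^ 2 - Real.sin B ^ 2 = Real.sin (A + B) * Real.sin (A - B) := by
    rw [Real.sin_add, Real.sin_sub]
    have h1 := Real.sin_sq_add_cos_sq A
    have h2 := Real.sin_sq_add_cos_sq B
    linear_combination (-Real.sin A ^ 2) * h2 + (Real.sin B ^ 2) * h1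
  have eAB : A + B = (2 * k + 1) * Real.pi / (2 * n) := by rw [hA, hB]; push_cast; field_simp; ring
  have eAB' : A - B = Real.pi / (2 * n) := by rw [hA, hB]; push_cast; field_simp; ring
  have p1 : 0 ≤ Real.sin (A + B) := by
    rw [eAB]; apply Real.sin_nonneg_of_nonneg_of_le_pi (by positivity)
    rw [div_le_iff₀ (by positivity)]; nlinarith
  have p2 : 0 ≤ Real.sin (A - B) := by
    rw [eAB']; apply Real.sin_nonneg_of_nonneg_of_le_pi (by positivity)
    rw [div_le_iff₀ (by positivity)]; nlinarith
  have q1 : Real.sin (A + B) ≤ (2 * k + 1) * Real.pi / (2 * n) := by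
    rw [← eAB]; exact Real.sin_le (by rw [eAB]; positivity)
  have q2 : Real.sin (A - B) ≤ Real.pi / (2 * n) := by
    rw [← eAB']; exact Real.sin_le (by rw [eAB']; positivity)
  have hd : -lamn n (k + 1) - -lamn n k = 4 * n ^ 2 * (Real.sin (A + B) * Real.sin (A - B)) := by
    rw [← e]; unfold lamn; rw [← hA, ← hB]; ring
  constructor
  · have : 0 ≤ 4 * (n : ℝ) ^ 2 * (Real.sin (A + B) * Real.sin (A - B)) := by positivity
    linarith
  · rw [hd]
    calc _ ≤ 4 * (n : ℝ) ^ 2 * ((2 * k + 1) * Real.pi / (2 * n) * (Real.pi / (2 * n))) := by gcongr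
      _ = _ := by field_simp; ring

lemma exp_diff (p q s : ℝ) (hpq : p ≤ q) (hs : 0 ≤ s) :
    0 ≤ Real.exp (-(p * s)) - Real.exp (-(q * s)) ∧
    Real.exp (-(p * s)) - Real.exp (-(q * s)) ≤ (q - p) * s * Real.exp (-(p * s)) := by
  constructor
  · rw [sub_nonneg]; apply Real.exp_le_exp.mpr; nlinarith
  · have e : Real.exp (-(q * s)) = Real.exp (-(p * s)) * Real.exp (-((q - p) * s)) := by
      rw [← Real.exp_add]; congr 1; ring
    rw [e]
    have h1 := Real.add_one_le_exp (-((q - p) * s))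
    have h2 := Real.exp_pos (-(p * s))
    nlinarith

lemma mult_single (n : ℕ) (hn : 0 < n) (s : ℝ) (hs : 0 < s) :
    MultHyp n s 1 (fun j => Real.exp (lamn n j * s)) := by
  constructor
  · intro k hk
    rw [abs_of_pos (Real.exp_pos _), one_mul]
    apply Real.exp_le_exp.mpr
    have := lamn_ub n k hn hk
    nlinarith [sq_nonneg (k : ℝ), mul_nonneg (sq_nonneg (k : ℝ)) hs.le]
  · intro k hk
    have h1 := lamn_ub n k hn hk.le
    obtain ⟨h2, h3⟩ := lamn_diff n k hn hk
    obtain ⟨e1, e2⟩ := exp_diff (-lamn n k) (-lamn n (k + 1)) s h2 hs.le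
    simp only [neg_mul, neg_neg] at e1 e2
    rw [abs_of_nonneg e1, one_mul]
    have hpi : Real.pi ^ 2 ≤ 10 := by nlinarith [Real.pi_lt_d2, Real.pi_pos]
    have h4 : Real.exp (lamn n k * s) ≤ Real.exp (-(2 * (k : ℝ) ^ 2 * s)) := by
      apply Real.exp_le_exp.mpr
      nlinarith [mul_nonneg (sq_nonneg (k : ℝ)) hs.le]
    have hk0 : (0 : ℝ) ≤ 2 * k + 1 := by positivity
    have h5 : -lamn n (k + 1) - -lamn n k ≤ 20 * (2 * k + 1) := by nlinarith
    calc _ ≤ _ := e2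
      _ ≤ (20 * (2 * k + 1)) * s * Real.exp (-(2 * (k : ℝ) ^ 2 * s)) := by
          have := Real.exp_pos (lamn n k * s)
          have h6 : 0 ≤ -lamn n (k + 1) - -lamn n k := by linarith
          gcongr
      _ = _ := by ring

lemma mult_large (n : ℕ) (hn : 0 < n) (T s : ℝ) (hT : 0 < T) (hs : T ≤ s) :
    MultHyp n T (1 + 1 / (20 * T)) (fun j => Real.exp (lamn n j * s)) := by
  have hb : ∀ k : ℕ, k ≤ n → Real.exp (lamn n k * s) ≤ Real.exp (-(2 * (k : ℝ) ^ 2 * T)) := by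
    intro k hk
    apply Real.exp_le_exp.mpr
    have := lamn_ub n k hn hk
    have h2 : 4 * (k : ℝ) ^ 2 * T ≤ -lamn n k * s := by
      have : 0 ≤ (k : ℝ) ^ 2 := sq_nonneg _
      gcongr
      linarith
    nlinarith [mul_nonneg (sq_nonneg (k : ℝ)) hT.le]
  constructor
  · intro k hk
    rw [abs_of_pos (Real.exp_pos _)]
    have h := hb k hk
    have h0 := Real.exp_pos (-(2 * (k : ℝ) ^ 2 * T))
    have : 0 < 1 / (20 * T) := by positivity
    nlinarith
  · intro k hk
    obtain ⟨h2, h3⟩ := lamn_diff n k hn hk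
    obtain ⟨e1, e2⟩ := exp_diff (-lamn n k) (-lamn n (k + 1)) s h2 (by linarith)
    simp only [neg_mul, neg_neg] at e1 e2
    rw [abs_of_nonneg e1]
    have h := hb k hk.le
    have h4 := Real.exp_pos (lamn n (k + 1) * s)
    set E := Real.exp (-(2 * (k : ℝ) ^ 2 * T)) with hE
    have hE0 : 0 < E := Real.exp_pos _
    calc _ ≤ E := by linarith
      _ ≤ (20 * T + 1) * E := by nlinarith
      _ = (1 + 1 / (20 * T)) * (20 * T * 1 * E) := by field_simp
      _ ≤ _ := by
        gcongr
        have : (0 : ℝ) ≤ k := by positivity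
        linarith

lemma mult_diff (n : ℕ) (hn : 0 < n) (τ δ : ℝ) (hτ : 0 < τ) (hδ : 0 ≤ δ) :
    MultHyp n τ (δ / τ) (fun j => Real.exp (lamn n j * τ) - Real.exp (lamn n j * (τ + δ))) := by
  have halfexp : ∀ u : ℝ, 0 ≤ u → (1 + u) * Real.exp (-u) ≤ 2 * Real.exp (-(u / 2)) := by
    intro u hu
    have e : Real.exp (-u) = Real.exp (-(u / 2)) * Real.exp (-(u / 2)) := by rw [← Real.exp_add]; congr 1; ring
    have h1 := Real.add_one_le_exp (u / 2)
    have h2 : (u / 2 + 1) * Real.exp (-(u / 2)) ≤ 1 := by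
      rw [Real.exp_neg, ← div_eq_mul_inv, div_le_one (Real.exp_pos _)]; exact h1
    have h3 := Real.exp_pos (-(u / 2))
    rw [e]
    nlinarith
  have halfexp' : ∀ u : ℝ, 0 ≤ u → u * Real.exp (-u) ≤ Real.exp (-(u / 2)) := by
    intro u hu
    have e : Real.exp (-u) = Real.exp (-(u / 2)) * Real.exp (-(u / 2)) := by rw [← Real.exp_add]; congr 1; ring
    have h1 := Real.add_one_le_exp (u / 2)
    have h1' : u ≤ Real.exp (u / 2) := by
      have := Real.quadratic_le_exp_of_nonneg (x := u / 2) (by linarith)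
      nlinarith [sq_nonneg (u / 2 - 1)]
    have h2 : u * Real.exp (-(u / 2)) ≤ 1 := by
      rw [Real.exp_neg, ← div_eq_mul_inv, div_le_one (Real.exp_pos _)]; exact h1'
    have h3 := Real.exp_pos (-(u / 2))
    rw [e]
    nlinarith
  have hex : ∀ k : ℕ, k ≤ n → Real.exp (-(-lamn n k * τ / 2)) ≤ Real.exp (-(2 * (k : ℝ) ^ 2 * τ)) := by
    intro k hk
    apply Real.exp_le_exp.mpr
    have := lamn_ub n k hn hk
    nlinarith
  have hp0 : ∀ k : ℕ, 0 ≤ -lamn n k := by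
    intro k; unfold lamn
    have : 0 ≤ 4 * (n : ℝ) ^ 2 * Real.sin (k * Real.pi / (2 * n)) ^ 2 := by positivity
    linarith
  have hrepr : ∀ k : ℕ, Real.exp (lamn n k * τ) - Real.exp (lamn n k * (τ + δ)) =
      Real.exp (-(-lamn n k * τ)) * (1 - Real.exp (-(-lamn n k * δ))) := by
    intro k
    rw [mul_sub, ← Real.exp_add]
    congr 2 <;> ring_nf
  have h1me : ∀ k : ℕ, 0 ≤ 1 - Real.exp (-(-lamn n k * δ)) ∧ 1 - Real.exp (-(-lamn n k * δ)) ≤ -lamn n k * δ := by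
    intro k
    have h1 := Real.add_one_le_exp (-(-lamn n k * δ))
    have h2 : Real.exp (-(-lamn n k * δ)) ≤ 1 := Real.exp_le_one_iff.mpr (by nlinarith [hp0 k])
    constructor <;> linarith
  constructor
  · intro k hk
    simp only
    rw [hrepr]
    obtain ⟨a1, a2⟩ := h1me k
    have hE := Real.exp_pos (-(-lamn n k * τ))
    rw [abs_of_nonneg (by positivity)]
    calc _ ≤ Real.exp (-(-lamn n k * τ)) * (-lamn n k * δ) := by gcongr
      _ = (δ / τ) * ((-lamn n k * τ) * Real.exp (-(-lamn n k * τ))) := by field_simp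
      _ ≤ _ := by
        gcongr
        exact (halfexp' _ (mul_nonneg (hp0 k) hτ.le)).trans (hex k hk)
  · intro k hk
    simp only
    rw [hrepr, hrepr]
    set p := -lamn n k with hp
    set q := -lamn n (k + 1) with hq
    have p0 : 0 ≤ p := hp0 k
    obtain ⟨hpq, hqp⟩ := lamn_diff n k hn hk
    rw [← hp, ← hq] at hpq hqp
    have hpi : Real.pi ^ 2 ≤ 10 := by nlinarith [Real.pi_lt_d2, Real.pi_pos]
    have hk0 : (0 : ℝ) ≤ 2 * k + 1 := by positivity
    have hqp' : q - p ≤ 10 * (2 * k + 1) := by nlinarith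
    have hqp0 : 0 ≤ q - p := by linarith
    obtain ⟨a1, a2⟩ := h1me k
    rw [← hp] at a1 a2
    obtain ⟨b1, b2⟩ := exp_diff p q τ hpq hτ.le
    obtain ⟨c1, c2⟩ := exp_diff p q δ hpq hδ
    have e : Real.exp (-(p * τ)) * (1 - Real.exp (-(p * δ))) - Real.exp (-(q * τ)) * (1 - Real.exp (-(q * δ)))
      = (Real.exp (-(p * τ)) - Real.exp (-(q * τ))) * (1 - Real.exp (-(p * δ)))
        - Real.exp (-(q * τ)) * (Real.exp (-(p * δ)) - Real.exp (-(q * δ))) := by ring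
    rw [e]
    have hEq := Real.exp_pos (-(q * τ))
    have hEp := Real.exp_pos (-(p * τ))
    have hEd : Real.exp (-(p * δ)) ≤ 1 := by linarith
    have t1 : (Real.exp (-(p * τ)) - Real.exp (-(q * τ))) * (1 - Real.exp (-(p * δ))) ≤
        ((q - p) * τ * Real.exp (-(p * τ))) * (p * δ) := by gcongr
    have t2 : Real.exp (-(q * τ)) * (Real.exp (-(p * δ)) - Real.exp (-(q * δ))) ≤
        Real.exp (-(p * τ)) * ((q - p) * δ) := by
      have : Real.exp (-(q * τ)) ≤ Real.exp (-(p * τ)) := by linarith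
      have h2 : Real.exp (-(p * δ)) - Real.exp (-(q * δ)) ≤ (q - p) * δ := by
        have : 0 ≤ (q - p) * δ := by positivity
        nlinarith
      gcongr
    have t1' : 0 ≤ (Real.exp (-(p * τ)) - Real.exp (-(q * τ))) * (1 - Real.exp (-(p * δ))) := by positivity
    have t2' : 0 ≤ Real.exp (-(q * τ)) * (Real.exp (-(p * δ)) - Real.exp (-(q * δ))) := by positivity
    calc _ ≤ ((q - p) * τ * Real.exp (-(p * τ))) * (p * δ) + Real.exp (-(p * τ)) * ((q - p) * δ) := by
          rw [abs_le]; constructor <;> linarith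
      _ = (q - p) * δ * ((1 + p * τ) * Real.exp (-(p * τ))) := by ring
      _ ≤ (10 * (2 * k + 1)) * δ * (2 * Real.exp (-(2 * (k : ℝ) ^ 2 * τ))) := by
          have h := (halfexp (p * τ) (by positivity))
          have h' := hex k hk.le
          rw [← hp] at h'
          have h'' : (1 + p * τ) * Real.exp (-(p * τ)) ≤ 2 * Real.exp (-(2 * (k : ℝ) ^ 2 * τ)) := by linarith
          gcongr
      _ = _ := by field_simp; ring

lemma W1_a (T : ℝ) (hT : 0 < T) (β : ℝ) (hβ0 : 0 ≤ β) (hβ : β < 1) :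
    ∃ C : ℝ, 0 < C ∧ ∀ n : ℕ, 0 < n → ∀ τ s : ℝ, 0 < τ → τ ≤ T → τ ≤ s → ∀ x y,
      W1 β y (Gn n s x) ≤ ENNReal.ofReal (C * τ ^ (-(β / 2))) := by
  obtain ⟨C, hC, h⟩ := oneD_core T hT β hβ0 hβ
  refine ⟨C * (1 + 1 / (20 * T)), by positivity, ?_⟩
  intro n hn τ s hτ hτT hτs x y
  have hA : (1 : ℝ) ≤ 1 + 1 / (20 * T) := by
    have : 0 < 1 / (20 * T) := by positivity
    linarith
  rcases le_total s T with hs | hs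
  · have hs0 : 0 < s := hτ.trans_le hτs
    refine (h n hn s 1 hs0 hs zero_le_one _ (mult_single n hn s hs0) x y).trans ?_
    apply ENNReal.ofReal_le_ofReal
    have : s ^ (-(β / 2)) ≤ τ ^ (-(β / 2)) := Real.rpow_le_rpow_of_nonpos hτ hτs (by linarith)
    gcongr
  · refine (h n hn T _ hT le_rfl (by positivity) _ (mult_large n hn T s hT hs) x y).trans ?_
    apply ENNReal.ofReal_le_ofReal
    have : T ^ (-(β / 2)) ≤ τ ^ (-(β / 2)) := Real.rpow_le_rpow_of_nonpos hτ hτT (by linarith)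
    gcongr

lemma Gn_meas (n : ℕ) (t x : ℝ) : Measurable (Gn n t x) := fF_meas n _ x

lemma W1_add_le (β y : ℝ) (f g : ℝ → ℝ) (hf : Measurable f) :
    W1 β y (fun z => f z - g z) ≤ W1 β y f + W1 β y g := by
  unfold W1
  rw [← lintegral_add_left (by fun_prop)]
  apply lintegral_mono
  intro z
  simp only
  rw [← add_mul]
  gcongr
  exact enorm_sub_le

lemma W1_symm (β y : ℝ) (f g : ℝ → ℝ) :
    W1 β y (fun z => f z - g z) = W1 β y (fun z => g z - f z) := by
  unfold W1
  congr 1; ext z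
  rw [← enorm_neg (f z - g z), neg_sub]

lemma W1_b0 (T : ℝ) (hT : 0 < T) (β : ℝ) (hβ0 : 0 ≤ β) (hβ : β < 1) :
    ∃ C : ℝ, 0 < C ∧ ∀ n : ℕ, 0 < n → ∀ t s : ℝ, 0 < t → t ≤ T → t ≤ s → ∀ x y,
      W1 β y (fun z => Gn n t x z - Gn n s x z) ≤
        ENNReal.ofReal (C * (min 1 ((s - t) / t)) * t ^ (-(β / 2))) := by
  obtain ⟨C, hC, h⟩ := oneD_core T hT β hβ0 hβ
  obtain ⟨C', hC', h'⟩ := W1_a T hT β hβ0 hβ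
  refine ⟨C + 2 * C', by positivity, ?_⟩
  intro n hn t s ht htT hts x y
  have hst : 0 ≤ (s - t) / t := div_nonneg (by linarith) ht.le
  have hp : 0 < t ^ (-(β / 2)) := Real.rpow_pos_of_pos ht _
  rcases le_total 1 ((s - t) / t) with h1 | h1
  · rw [min_eq_left h1]
    refine (W1_add_le β y _ _ (Gn_meas n t x)).trans ?_
    refine (add_le_add (h' n hn t t ht htT le_rfl x y) (h' n hn t s ht htT hts x y)).trans ?_
    rw [← ENNReal.ofReal_add (by positivity) (by positivity)]
    apply ENNReal.ofReal_le_ofReal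
    nlinarith
  · rw [min_eq_right h1]
    have := h n hn t ((s - t) / t) ht htT hst _ (mult_diff n hn t (s - t) ht (by linarith)) x y
    have e : (fun z => Gn n t x z - Gn n s x z) =
      fF n (fun j => Real.exp (lamn n j * t) - Real.exp (lamn n j * (t + (s - t)))) x := by
      ext z
      unfold Gn fF
      rw [← Finset.sum_sub_distrib]
      apply Finset.sum_congr rfl
      intro j _
      rw [add_sub_cancel]
      ring
    rw [e]
    refine this.trans ?_
    apply ENNReal.ofReal_le_ofReal
    gcongr
    linarith

/-- relative size of a time increment -/
noncomputable def eps (t s : ℝ) : ℝ := min 1 (|t - s| / min t s)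

lemma eps_nonneg {t s : ℝ} (ht : 0 < t) (hs : 0 < s) : 0 ≤ eps t s := by
  unfold eps
  have : 0 < min t s := lt_min ht hs
  positivity

lemma W1_b (T : ℝ) (hT : 0 < T) (β : ℝ) (hβ0 : 0 ≤ β) (hβ : β < 1) :
    ∃ C : ℝ, 0 < C ∧ ∀ n : ℕ, 0 < n → ∀ t s : ℝ, 0 < t → t ≤ T → 0 < s → ∀ x y,
      W1 β y (fun z => Gn n t x z - Gn n s x z) ≤
        ENNReal.ofReal (C * eps t s * (min t s) ^ (-(β / 2))) := by
  obtain ⟨C, hC, h⟩ := W1_b0 T hT β hβ0 hβ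
  refine ⟨C, hC, ?_⟩
  intro n hn t s ht htT hs x y
  unfold eps
  rcases le_total t s with hts | hts
  · rw [min_eq_left hts, abs_sub_comm, abs_of_nonneg (by linarith)]
    exact h n hn t s ht htT hts x y
  · rw [min_eq_right hts, abs_of_nonneg (by linarith), W1_symm]
    exact h n hn s t hs (hts.trans htT) hts x y

lemma enorm_fprod {ι : Type*} [DecidableEq ι] (s : Finset ι) (a : ι → ℝ) :
    ‖∏ i ∈ s, a i‖ₑ = ∏ i ∈ s, ‖a i‖ₑ := by
  induction s using Finset.induction_on with
  | empty => simp
  | insert k s hk ih =>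
    rw [Finset.prod_insert hk, Finset.prod_insert hk, enorm_mul, ih]

lemma prod_diff_enorm {ι : Type*} [DecidableEq ι] (s : Finset ι) (a b : ι → ℝ) :
    ‖∏ i ∈ s, a i - ∏ i ∈ s, b i‖ₑ ≤
      ∑ i ∈ s, ∏ j ∈ s, (if j = i then ‖a j - b j‖ₑ else ‖a j‖ₑ + ‖b j‖ₑ) := by
  induction s using Finset.induction_on with
  | empty => simp
  | insert k s hk ih =>
    rw [Finset.prod_insert hk, Finset.prod_insert hk, Finset.sum_insert hk]
    have e : a k * ∏ i ∈ s, a i - b k * ∏ i ∈ s, b i =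
      (a k - b k) * ∏ i ∈ s, a i + b k * (∏ i ∈ s, a i - ∏ i ∈ s, b i) := by ring
    rw [e]
    refine (enorm_add_le _ _).trans ?_
    rw [enorm_mul, enorm_mul]
    apply add_le_add
    · rw [Finset.prod_insert hk, if_pos rfl]
      gcongr
      have : ‖∏ i ∈ s, a i‖ₑ = ∏ i ∈ s, ‖a i‖ₑ := enorm_fprod s a
      rw [this]
      apply Finset.prod_le_prod'
      intro i hi
      rw [if_neg (by rintro rfl; exact hk hi)]
      exact le_self_add
    · refine (mul_le_mul' (le_add_self (a := ‖b k‖ₑ) (b := ‖a k‖ₑ)) ih).trans ?_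
      rw [Finset.mul_sum]
      apply Finset.sum_le_sum
      intro i hi
      rw [Finset.prod_insert hk, if_neg (by rintro rfl; exact hk hi)]

lemma lint_prod (d : ℕ) (h : Fin d → ℝ → ENNReal) (hm : ∀ i, Measurable (h i)) :
    ∫⁻ z in Q d, ∏ i, h i (z i) = ∏ i, ∫⁻ z in Set.Icc (0 : ℝ) 1, h i z := by
  have hmp := (EuclideanSpace.volume_preserving_symm_measurableEquiv_toLp (Fin d)).symm
  have hpre : (MeasurableEquiv.toLp 2 (Fin d → ℝ)) ⁻¹' (Q d) = Set.univ.pi (fun _ => Set.Icc (0 : ℝ) 1) := by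
    ext z; simp only [Q, Set.mem_preimage, Set.mem_setOf_eq, Set.mem_pi, Set.mem_univ, true_imp_iff]; rfl
  rw [← MeasurePreserving.setLIntegral_comp_preimage_emb hmp (MeasurableEquiv.measurableEmbedding _)]
  simp only [MeasurableEquiv.symm_symm]
  rw [hpre, volume_pi, Measure.restrict_pi_pi]
  have : IsProbabilityMeasure ((volume : Measure ℝ).restrict (Set.Icc (0 : ℝ) 1)) := ⟨by simp⟩
  have hi := ProbabilityTheory.iIndepFun_pi (μ := fun _ : Fin d => (volume : Measure ℝ).restrict (Set.Icc (0 : ℝ) 1))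
    (X := h) (fun i => (hm i).aemeasurable)
  have := ProbabilityTheory.lintegral_prod_eq_prod_lintegral_of_indepFun Finset.univ _ hi
    (fun i => (hm i).comp (measurable_pi_apply i))
  simp only [MeasurableEquiv.toLp_apply]
  refine this.trans ?_
  apply Finset.prod_congr rfl
  intro i _
  exact (measurePreserving_eval (fun _ : Fin d => (volume : Measure ℝ).restrict (Set.Icc (0 : ℝ) 1)) i).lintegral_comp (hm i)

/-- potential of `f` at `y` in dimension `d` -/
noncomputable def Wd (d : ℕ) (α : ℝ) (y : EuclideanSpace ℝ (Fin d)) (f : EuclideanSpace ℝ (Fin d) → ℝ) : ENNReal :=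
  ∫⁻ z in Q d, ‖f z‖ₑ * ‖y - z‖ₑ ^ (-α)

lemma kernel_le (d : ℕ) (hd : 1 ≤ d) (α : ℝ) (hα : 0 ≤ α) (w : EuclideanSpace ℝ (Fin d)) :
    ‖w‖ₑ ^ (-α) ≤ ∏ i, ‖w i‖ₑ ^ (-(α / d)) := by
  have hd0 : (d : ℝ) ≠ 0 := by positivity
  have : ‖w‖ₑ ^ (-α) = ∏ _i : Fin d, ‖w‖ₑ ^ (-(α / d)) := by
    rw [Finset.prod_const, Finset.card_univ, Fintype.card_fin, ← ENNReal.rpow_natCast, ← ENNReal.rpow_mul]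
    congr 1; field_simp
  rw [this]
  apply Finset.prod_le_prod'
  intro i _
  rw [ENNReal.rpow_neg, ENNReal.rpow_neg]
  gcongr
  exact PiLp.enorm_apply_le w i

lemma Wd_b (T : ℝ) (hT : 0 < T) (d : ℕ) (hd : 1 ≤ d) (α : ℝ) (hα0 : 0 ≤ α) (hα : α < d) :
    ∃ C : ℝ, 0 < C ∧ ∀ n : ℕ, 0 < n → ∀ t s : ℝ, 0 < t → t ≤ T → 0 < s → ∀ x y,
      Wd d α y (fun z => Gdn d n t x z - Gdn d n s x z) ≤
        ENNReal.ofReal (C * eps t s * (min t s) ^ (-(α / 2))) := by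
  have hd0 : (0 : ℝ) < d := by positivity
  have hβ0 : 0 ≤ α / d := by positivity
  have hβ : α / d < 1 := by rw [div_lt_one hd0]; exact hα
  obtain ⟨Ca, hCa, ha⟩ := W1_a T hT (α / d) hβ0 hβ
  obtain ⟨Cb, hCb, hb⟩ := W1_b T hT (α / d) hβ0 hβ
  set D : ℝ := max (2 * Ca) Cb with hD
  have hD0 : 0 < D := lt_max_of_lt_right hCb
  refine ⟨d * D ^ d, by positivity, ?_⟩
  intro n hn t s ht htT hs x y
  have hτ : 0 < min t s := lt_min ht hs
  set τ := min t s with hτd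
  have he := eps_nonneg ht hs
  set P : ℝ := τ ^ (-(α / d / 2)) with hP
  have hP0 : 0 < P := Real.rpow_pos_of_pos hτ _
  have hPd : P ^ d = τ ^ (-(α / 2)) := by
    rw [hP, ← Real.rpow_natCast, ← Real.rpow_mul hτ.le]
    congr 1; field_simp
  set hh : Fin d → Fin d → ℝ → ENNReal := fun i j z =>
    (if j = i then ‖Gn n t (x j) z - Gn n s (x j) z‖ₑ else ‖Gn n t (x j) z‖ₑ + ‖Gn n s (x j) z‖ₑ)
      * ‖y j - z‖ₑ ^ (-(α / d)) with hhd
  have hmeas : ∀ i j, Measurable (hh i j) := by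
    intro i j
    have h1 := Gn_meas n t (x j)
    have h2 := Gn_meas n s (x j)
    simp only [hhd]
    split_ifs <;> fun_prop
  have step : Wd d α y (fun z => Gdn d n t x z - Gdn d n s x z) ≤
      ∑ i, ∏ j, ∫⁻ z in Set.Icc (0 : ℝ) 1, hh i j z := by
    calc _ ≤ ∫⁻ z in Q d, ∑ i, ∏ j, hh i j (z j) := by
          apply lintegral_mono
          intro z
          simp only [hhd, Finset.prod_mul_distrib]
          rw [← Finset.sum_mul]
          refine mul_le_mul' (prod_diff_enorm _ _ _) ?_
          have := kernel_le d hd α hα0 (y - z)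
          simpa using this
      _ = ∑ i, ∫⁻ z in Q d, ∏ j, hh i j (z j) := by
          rw [lintegral_finsetSum]
          intro i _
          apply Finset.measurable_prod
          intro j _
          exact (hmeas i j).comp (by fun_prop)
      _ = _ := by
          apply Finset.sum_congr rfl
          intro i _
          exact lint_prod d _ (hmeas i)
  refine step.trans ?_
  have each : ∀ i : Fin d, ∏ j, ∫⁻ z in Set.Icc (0 : ℝ) 1, hh i j z ≤
      ENNReal.ofReal (D ^ d * eps t s * τ ^ (-(α / 2))) := by
    intro i
    have : ∀ j : Fin d, ∫⁻ z in Set.Icc (0 : ℝ) 1, hh i j z ≤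
        ENNReal.ofReal ((if j = i then eps t s else 1) * (D * P)) := by
      intro j
      by_cases hij : j = i
      · simp only [hhd, if_pos hij]
        refine (hb n hn t s ht htT hs (x j) (y j)).trans ?_
        apply ENNReal.ofReal_le_ofReal
        have : Cb ≤ D := le_max_right _ _
        calc _ = eps t s * (Cb * P) := by ring
          _ ≤ _ := by gcongr
      · simp only [hhd, if_neg hij, add_mul]
        rw [lintegral_add_left (by have := Gn_meas n t (x j); fun_prop)]
        refine (add_le_add (ha n hn τ t hτ ((min_le_left _ _).trans htT) (min_le_left _ _) (x j) (y j))
          (ha n hn τ s hτ ((min_le_left _ _).trans htT) (min_le_right _ _) (x j) (y j))).trans ?_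
        rw [← ENNReal.ofReal_add (by positivity) (by positivity)]
        apply ENNReal.ofReal_le_ofReal
        have : 2 * Ca ≤ D := le_max_left _ _
        calc _ = (2 * Ca) * P := by ring
          _ ≤ _ := by rw [one_mul]; gcongr
    refine (Finset.prod_le_prod' (fun j _ => this j)).trans ?_
    rw [← ENNReal.ofReal_prod_of_nonneg (by intro j _; split_ifs <;> positivity)]
    apply ENNReal.ofReal_le_ofReal
    rw [Finset.prod_mul_distrib, Finset.prod_ite_eq' ]
    simp only [Finset.mem_univ, if_true, Finset.prod_const, Finset.card_univ, Fintype.card_fin]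
    rw [mul_pow, hPd]
    apply le_of_eq; ring
  refine (Finset.sum_le_sum (fun i _ => each i)).trans ?_
  rw [Finset.sum_const, Finset.card_univ, Fintype.card_fin, nsmul_eq_mul, ← ENNReal.ofReal_natCast,
    ← ENNReal.ofReal_mul (by positivity)]
  apply ENNReal.ofReal_le_ofReal
  apply le_of_eq; ring

/-- Gamma density with parameter `p + 1` -/
noncomputable def gam (p : ℕ) (r : ℝ) : ℝ := r ^ p * Real.exp (-r) / (p.factorial : ℝ)

lemma gam_nonneg (p : ℕ) {r : ℝ} (hr : 0 ≤ r) : 0 ≤ gam p r := by unfold gam; positivity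

lemma gam_cont (p : ℕ) : Continuous (gam p) := by unfold gam; fun_prop

lemma gam_laplace (p : ℕ) (c : ℝ) (hc : 0 < c) :
    ∫ r in Set.Ioi (0 : ℝ), gam p r * Real.exp (-((c - 1) * r)) = (c ^ (p + 1))⁻¹ := by
  have h := Real.integral_rpow_mul_exp_neg_mul_Ioi (a := (p : ℝ) + 1) (r := c) (by positivity) hc
  rw [Real.Gamma_nat_eq_factorial] at h
  have e : ∀ r ∈ Set.Ioi (0 : ℝ), gam p r * Real.exp (-((c - 1) * r)) =
      (r ^ ((p : ℝ) + 1 - 1) * Real.exp (-(c * r))) * ((p.factorial : ℝ))⁻¹ := by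
    intro r _
    unfold gam
    rw [add_sub_cancel_right, Real.rpow_natCast]
    have : Real.exp (-(c * r)) = Real.exp (-r) * Real.exp (-((c - 1) * r)) := by
      rw [← Real.exp_add]; congr 1; ring
    rw [this]; field_simp
  rw [setIntegral_congr_fun measurableSet_Ioi e, integral_mul_const, h]
  have : (1 / c) ^ ((p : ℝ) + 1) = (c ^ (p + 1))⁻¹ := by
    rw [one_div, show (p : ℝ) + 1 = ((p + 1 : ℕ) : ℝ) by push_cast; rfl,
      Real.rpow_natCast, inv_pow]
  rw [this]
  have := p.factorial_ne_zero
  field_simp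

lemma gam_laplace_int (p : ℕ) (c : ℝ) (hc : 0 < c) :
    IntegrableOn (fun r => gam p r * Real.exp (-((c - 1) * r))) (Set.Ioi (0 : ℝ)) := by
  apply Integrable.of_integral_ne_zero
  rw [gam_laplace p c hc]
  positivity

lemma gam_one (p : ℕ) : ∫ r in Set.Ioi (0 : ℝ), gam p r = 1 := by
  simpa using gam_laplace p 1 one_pos

lemma gam_int (p : ℕ) : IntegrableOn (gam p) (Set.Ioi (0 : ℝ)) := by
  simpa using gam_laplace_int p 1 one_pos

lemma gam_succ (p : ℕ) (r : ℝ) : gam p r * r = ((p : ℝ) + 1) * gam (p + 1) r := by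
  unfold gam
  rw [Nat.factorial_succ]
  have := p.factorial_ne_zero
  push_cast
  field_simp
  rw [pow_succ]

lemma gam_mom_eq (q : ℕ) (h t δ r : ℝ) :
    gam q r * ((h * r - t) ^ 2 / δ + δ) =
      (h ^ 2 * (q + 1) * (q + 2) / δ) * gam (q + 2) r - (2 * h * t * (q + 1) / δ) * gam (q + 1) r +
        (t ^ 2 / δ + δ) * gam q r := by
  have h1 := gam_succ q r
  have h2 := gam_succ (q + 1) r
  push_cast at h2
  have h3 : gam q r * r ^ 2 = (q + 1) * ((q + 1 + 1) * gam (q + 2) r) := by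
    rw [← h2, ← mul_assoc, ← h1]; ring
  calc _ = (h ^ 2 / δ) * (gam q r * r ^ 2) - (2 * h * t / δ) * (gam q r * r) + (t ^ 2 / δ + δ) * gam q r := by ring
    _ = _ := by rw [h3, h1]; ring

lemma gam_mom_int (q : ℕ) (h t δ : ℝ) :
    IntegrableOn (fun r => gam q r * ((h * r - t) ^ 2 / δ + δ)) (Set.Ioi (0 : ℝ)) := by
  simp only [gam_mom_eq]
  exact (((gam_int (q + 2)).const_mul _).sub ((gam_int (q + 1)).const_mul _)).add ((gam_int q).const_mul _)

lemma gam_mom (q : ℕ) (h t δ : ℝ) :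
    ∫ r in Set.Ioi (0 : ℝ), gam q r * ((h * r - t) ^ 2 / δ + δ) =
      (h ^ 2 * (q + 1) + (h * (q + 1) - t) ^ 2) / δ + δ := by
  simp only [gam_mom_eq]
  have i12 : IntegrableOn (fun r => h ^ 2 * ((q : ℝ) + 1) * (q + 2) / δ * gam (q + 2) r -
      2 * h * t * (q + 1) / δ * gam (q + 1) r) (Set.Ioi (0 : ℝ)) :=
    ((gam_int (q + 2)).const_mul _).sub ((gam_int (q + 1)).const_mul _)
  rw [integral_add i12 ((gam_int q).const_mul _),
    integral_sub ((gam_int (q + 2)).const_mul _) ((gam_int (q + 1)).const_mul _),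
    integral_const_mul, integral_const_mul, integral_const_mul, gam_one, gam_one, gam_one]
  ring

lemma eps_le_one (t s : ℝ) : eps t s ≤ 1 := min_le_left _ _

lemma eps_le (t s : ℝ) (ht : 0 < t) (hs : 0 < s) : eps t s ≤ 2 * |s - t| / t := by
  unfold eps
  rw [abs_sub_comm]
  have ha := abs_nonneg (s - t)
  rcases le_total t s with h | h
  · rw [min_eq_left h]
    refine (min_le_right _ _).trans ?_
    gcongr; linarith
  · rw [min_eq_right h]
    rcases le_total (t / 2) s with h2 | h2
    · refine (min_le_right _ _).trans ?_
      rw [div_le_div_iff₀ hs ht]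
      nlinarith
    · refine (min_le_left _ _).trans ?_
      rw [le_div_iff₀ ht, abs_sub_comm, abs_of_nonneg (by linarith)]
      linarith

lemma minpow_le (t s a : ℝ) (ht : 0 < t) (hs : 0 < s) (ha0 : 0 ≤ a) (ha : a ≤ 1) :
    (min t s) ^ (-a) ≤ t ^ (-a) * (1 + t / s) := by
  have hp : 0 < t ^ (-a) := Real.rpow_pos_of_pos ht _
  have hts : 0 < t / s := by positivity
  rcases le_total t s with h | h
  · rw [min_eq_left h]; nlinarith
  · rw [min_eq_right h]
    have e : s ^ (-a) = t ^ (-a) * (t / s) ^ a := by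
      rw [Real.div_rpow ht.le hs.le, Real.rpow_neg hs.le, Real.rpow_neg ht.le]
      have := (Real.rpow_pos_of_pos ht a).ne'
      field_simp
    rw [e]
    have h1 : 1 ≤ t / s := by rw [le_div_iff₀ hs]; linarith
    have : (t / s) ^ a ≤ t / s := by
      simpa using Real.rpow_le_rpow_of_exponent_le h1 ha
    gcongr; linarith

lemma case_large (a h t : ℝ) (p : ℕ) (ha0 : 0 ≤ a) (ha : a ≤ 1) (hh : 0 < h) (hp : 1 ≤ p)
    (h1 : h * p ≤ t) (h2 : t ≤ h * (p + 1)) :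
    ∫⁻ r in Set.Ioi (0 : ℝ), ENNReal.ofReal (gam p r * (eps t (h * r) * (min t (h * r)) ^ (-a))) ≤
      ENNReal.ofReal (12 * t ^ (-a) * Real.sqrt (h / t)) := by
  have hp1 : (1 : ℝ) ≤ p := by exact_mod_cast hp
  have hht : h ≤ t := by nlinarith
  have ht : 0 < t := hh.trans_le hht
  obtain ⟨q, rfl⟩ : ∃ q, p = q + 1 := ⟨p - 1, by omega⟩
  push_cast at *
  set δ := Real.sqrt (h * t) with hδ
  have hδ0 : 0 < δ := Real.sqrt_pos.mpr (by positivity)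
  have hδ2 : δ ^ 2 = h * t := Real.sq_sqrt (by positivity)
  have hta : 0 < t ^ (-a) := Real.rpow_pos_of_pos ht _
  set Φ : ℝ → ℝ := fun r => (h * r - t) ^ 2 / δ + δ with hΦ
  have hb : ∀ r, |h * r - t| ≤ Φ r / 2 := by
    intro r
    simp only [hΦ]
    rw [← sq_abs, div_add' _ _ _ hδ0.ne', div_div, le_div_iff₀ (by positivity)]
    nlinarith [sq_nonneg (|h * r - t| - δ)]
  set Gf : ℝ → ℝ := fun r => (2 * t ^ (-a)) * ((gam (q + 1) r * Φ r) * (1 / (2 * t)) +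
    (gam q r * Φ r) * (1 / (2 * (h * (q + 1))))) with hGf
  have i1 := gam_mom_int (q + 1) h t δ
  have i2 := gam_mom_int q h t δ
  have hGi : IntegrableOn Gf (Set.Ioi 0) := ((i1.mul_const _).add (i2.mul_const _)).const_mul _
  have hq0 : (0 : ℝ) ≤ q := by positivity
  have hG0 : ∀ r ∈ Set.Ioi (0 : ℝ), 0 ≤ Gf r := by
    intro r hr
    have g1 := gam_nonneg (q + 1) (le_of_lt hr)
    have g2 := gam_nonneg q (le_of_lt hr)
    simp only [hGf, hΦ]
    positivity
  have hle : ∀ r ∈ Set.Ioi (0 : ℝ), gam (q + 1) r * (eps t (h * r) * (min t (h * r)) ^ (-a)) ≤ Gf r := by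
    intro r hr
    have hr0 : (0 : ℝ) < r := hr
    have hs : 0 < h * r := by positivity
    have g1 := gam_nonneg (q + 1) (le_of_lt hr)
    have g2 := gam_nonneg q (le_of_lt hr)
    have e1 := eps_le t (h * r) ht hs
    have e2 := minpow_le t (h * r) a ht hs ha0 ha
    have e0 := eps_nonneg ht hs
    have hg := gam_succ q r
    have hm0 : 0 ≤ (min t (h * r)) ^ (-a) := Real.rpow_nonneg (lt_min ht hs).le _
    calc gam (q + 1) r * (eps t (h * r) * (min t (h * r)) ^ (-a))
        ≤ gam (q + 1) r * ((2 * |h * r - t| / t) * (t ^ (-a) * (1 + t / (h * r)))) := by gcongr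
      _ = (2 * t ^ (-a)) * ((gam (q + 1) r * |h * r - t|) * (1 / t) +
            ((((q : ℝ) + 1) * gam (q + 1) r) / r * |h * r - t|) * (1 / (h * (q + 1)))) := by
          field_simp
      _ = (2 * t ^ (-a)) * ((gam (q + 1) r * |h * r - t|) * (1 / t) +
            (gam q r * |h * r - t|) * (1 / (h * (q + 1)))) := by
          rw [← hg, mul_div_cancel_right₀ _ hr0.ne']
      _ ≤ (2 * t ^ (-a)) * ((gam (q + 1) r * (Φ r / 2)) * (1 / t) +
            (gam q r * (Φ r / 2)) * (1 / (h * (q + 1)))) := by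
          have := hb r
          gcongr
      _ = Gf r := by simp only [hGf]; field_simp
  calc _ ≤ ∫⁻ r in Set.Ioi (0 : ℝ), ENNReal.ofReal (Gf r) := by
        apply setLIntegral_mono' measurableSet_Ioi
        intro r hr
        exact ENNReal.ofReal_le_ofReal (hle r hr)
    _ = ENNReal.ofReal (∫ r in Set.Ioi (0 : ℝ), Gf r) := by
        rw [ofReal_integral_eq_lintegral_ofReal hGi]
        exact (ae_restrict_iff' measurableSet_Ioi).mpr (Filter.Eventually.of_forall hG0)
    _ ≤ _ := by
        apply ENNReal.ofReal_le_ofReal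
        simp only [hGf]
        rw [integral_const_mul, integral_add (i1.mul_const _) (i2.mul_const _), integral_mul_const,
          integral_mul_const, gam_mom, gam_mom]
        push_cast
        have m1 : (h ^ 2 * ((q : ℝ) + 1 + 1) + (h * (q + 1 + 1) - t) ^ 2) / δ + δ ≤ 4 * δ := by
          have : (h ^ 2 * ((q : ℝ) + 1 + 1) + (h * (q + 1 + 1) - t) ^ 2) / δ ≤ 3 * δ := by
            rw [div_le_iff₀ hδ0]
            have : (h * ((q : ℝ) + 1 + 1) - t) ^ 2 ≤ h ^ 2 := by
              apply sq_le_sq' <;> nlinarith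
            nlinarith
          linarith
        have m2 : (h ^ 2 * ((q : ℝ) + 1) + (h * (q + 1) - t) ^ 2) / δ + δ ≤ 4 * δ := by
          have : (h ^ 2 * ((q : ℝ) + 1) + (h * (q + 1) - t) ^ 2) / δ ≤ 3 * δ := by
            rw [div_le_iff₀ hδ0]
            have : (h * ((q : ℝ) + 1) - t) ^ 2 ≤ h ^ 2 := by
              apply sq_le_sq' <;> nlinarith
            nlinarith
          linarith
        have m3 : 1 / (2 * (h * ((q : ℝ) + 1))) ≤ 1 / t := by
          apply one_div_le_one_div_of_le ht
          nlinarith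
        have hsq : Real.sqrt (h / t) = δ / t := by
          rw [eq_div_iff ht.ne', hδ]
          have : t = Real.sqrt (t ^ 2) := (Real.sqrt_sq ht.le).symm
          nth_rw 2 [this]
          rw [← Real.sqrt_mul (by positivity)]
          congr 1; field_simp
        rw [hsq]
        calc _ ≤ 2 * t ^ (-a) * (4 * δ * (1 / (2 * t)) + 4 * δ * (1 / t)) := by gcongr
          _ = _ := by field_simp; ring

lemma case_small (a h t : ℝ) (ha0 : 0 ≤ a) (ha : a < 1) (hh : 0 < h) (ht : 0 < t) (hth : t ≤ h) :
    ∫⁻ r in Set.Ioi (0 : ℝ), ENNReal.ofReal (gam 0 r * (eps t (h * r) * (min t (h * r)) ^ (-a))) ≤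
      ENNReal.ofReal ((1 + Real.Gamma (1 - a)) * t ^ (-a)) := by
  have hta : 0 < t ^ (-a) := Real.rpow_pos_of_pos ht _
  have hgi := Real.GammaIntegral_convergent (s := 1 - a) (by linarith)
  have hgv := Real.Gamma_eq_integral (s := 1 - a) (by linarith)
  have hi : IntegrableOn (fun r => (gam 0 r + Real.exp (-r) * r ^ (1 - a - 1)) * t ^ (-a)) (Set.Ioi (0 : ℝ)) :=
    ((gam_int 0).add hgi).mul_const _
  calc _ ≤ ∫⁻ r in Set.Ioi (0 : ℝ), ENNReal.ofReal ((gam 0 r + Real.exp (-r) * r ^ (1 - a - 1)) * t ^ (-a)) := by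
        apply setLIntegral_mono' measurableSet_Ioi
        intro r hr
        have hr0 : (0 : ℝ) < r := hr
        apply ENNReal.ofReal_le_ofReal
        have hs : 0 < h * r := by positivity
        have e0 := eps_nonneg ht hs
        have e1 := eps_le_one t (h * r)
        have g0 := gam_nonneg 0 hr0.le
        have hra : 0 < r ^ (-a) := Real.rpow_pos_of_pos hr0 _
        have hm : (min t (h * r)) ^ (-a) ≤ t ^ (-a) * (1 + r ^ (-a)) := by
          rcases le_total t (h * r) with hc | hc
          · rw [min_eq_left hc]; nlinarith
          · rw [min_eq_right hc, Real.mul_rpow hh.le hr0.le]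
            have : h ^ (-a) ≤ t ^ (-a) := Real.rpow_le_rpow_of_nonpos ht hth (by linarith)
            nlinarith
        have hm0 : 0 ≤ (min t (h * r)) ^ (-a) := Real.rpow_nonneg (lt_min ht hs).le _
        calc _ ≤ gam 0 r * (1 * (t ^ (-a) * (1 + r ^ (-a)))) := by gcongr
          _ = _ := by
            rw [show 1 - a - 1 = -a by ring]
            simp [gam]; ring
    _ = ENNReal.ofReal (∫ r in Set.Ioi (0 : ℝ), ((gam 0 r + Real.exp (-r) * r ^ (1 - a - 1)) * t ^ (-a))) := by
        rw [ofReal_integral_eq_lintegral_ofReal hi]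
        refine (ae_restrict_iff' measurableSet_Ioi).mpr (Filter.Eventually.of_forall ?_)
        intro r hr
        have hr0 : (0 : ℝ) < r := hr
        have g0 := gam_nonneg 0 hr0.le
        simp only [Pi.zero_apply]
        positivity
    _ ≤ _ := by
        rw [integral_mul_const, integral_add (gam_int 0) hgi, gam_one, ← hgv]

lemma lamn_nonpos (n j : ℕ) : lamn n j ≤ 0 := by
  unfold lamn
  have : 0 ≤ (n : ℝ) ^ 2 * Real.sin ((j : ℝ) * Real.pi / (2 * n)) ^ 2 := by positivity
  linarith

lemma Gdn_expand (d n : ℕ) (s : ℝ) (x z : EuclideanSpace ℝ (Fin d)) :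
    Gdn d n s x z = ∑ k ∈ Finset.Icc (fun _ : Fin d => 1) (fun _ : Fin d => n - 1),
      Real.exp ((∑ i, lamn n (k i)) * s) * ((∏ i, phiLin n (k i) (x i)) * ∏ i, phiF (k i) (kappa n (z i))) := by
  unfold Gdn Gn
  rw [Finset.prod_univ_sum, Pi.Icc_eq]
  apply Finset.sum_congr rfl
  intro k _
  rw [Finset.prod_mul_distrib, Finset.prod_mul_distrib, Finset.sum_mul, Real.exp_sum]
  ring

lemma Gdnm_repr (d n m : ℕ) (hm : 1 ≤ m) (T t : ℝ) (hT : 0 < T) (ht : 0 ≤ t)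
    (x z : EuclideanSpace ℝ (Fin d)) :
    IntegrableOn (fun r => gam ⌊(m : ℝ) * t / T⌋₊ r * Gdn d n (T / m * r) x z) (Set.Ioi 0) ∧
    Gdnm d T n m (t + T / m) x z =
      ∫ r in Set.Ioi (0 : ℝ), gam ⌊(m : ℝ) * t / T⌋₊ r * Gdn d n (T / m * r) x z := by
  have hm0 : (0 : ℝ) < m := by exact_mod_cast hm
  set p := ⌊(m : ℝ) * t / T⌋₊ with hp
  have hfl : ⌊(m : ℝ) * (t + T / m) / T⌋ = ((p + 1 : ℕ) : ℤ) := by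
    have : (m : ℝ) * (t + T / m) / T = (m : ℝ) * t / T + 1 := by field_simp
    rw [this, Int.floor_add_one, hp]
    push_cast
    rw [Int.natCast_floor_eq_floor (by positivity)]
  have hc : ∀ k : Fin d → ℕ, 0 < 1 - T / (m : ℝ) * ∑ i, lamn n (k i) := by
    intro k
    have : ∑ i, lamn n (k i) ≤ 0 := Finset.sum_nonpos (fun i _ => lamn_nonpos n _)
    have h2 : 0 < T / (m : ℝ) := by positivity
    nlinarith
  have e : (fun r => gam p r * Gdn d n (T / m * r) x z) = fun r =>
      ∑ k ∈ Finset.Icc (fun _ : Fin d => 1) (fun _ : Fin d => n - 1),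
        (gam p r * Real.exp (-(((1 - T / (m : ℝ) * ∑ i, lamn n (k i)) - 1) * r))) *
          ((∏ i, phiLin n (k i) (x i)) * ∏ i, phiF (k i) (kappa n (z i))) := by
    ext r
    rw [Gdn_expand, Finset.mul_sum]
    apply Finset.sum_congr rfl
    intro k _
    rw [show -(((1 - T / (m : ℝ) * ∑ i, lamn n (k i)) - 1) * r) = (∑ i, lamn n (k i)) * (T / m * r) by ring]
    ring
  have hi : ∀ k ∈ Finset.Icc (fun _ : Fin d => 1) (fun _ : Fin d => n - 1), IntegrableOn (fun r =>
        (gam p r * Real.exp (-(((1 - T / (m : ℝ) * ∑ i, lamn n (k i)) - 1) * r))) *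
          ((∏ i, phiLin n (k i) (x i)) * ∏ i, phiF (k i) (kappa n (z i)))) (Set.Ioi 0) :=
    fun k _ => (gam_laplace_int p _ (hc k)).mul_const _
  rw [e]
  constructor
  · exact integrable_finsetSum _ hi
  · rw [integral_finsetSum _ hi]
    unfold Gdnm
    apply Finset.sum_congr rfl
    intro k _
    rw [integral_mul_const, gam_laplace p _ (hc k), hfl, zpow_neg, zpow_natCast]
    ring

lemma diff_enorm (d n m : ℕ) (hm : 1 ≤ m) (T t : ℝ) (hT : 0 < T) (ht : 0 ≤ t)
    (x z : EuclideanSpace ℝ (Fin d)) :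
    ‖Gdn d n t x z - Gdnm d T n m (t + T / m) x z‖ₑ ≤
      ∫⁻ r in Set.Ioi (0 : ℝ), ‖gam ⌊(m : ℝ) * t / T⌋₊ r‖ₑ * ‖Gdn d n t x z - Gdn d n (T / m * r) x z‖ₑ := by
  obtain ⟨hi, he⟩ := Gdnm_repr d n m hm T t hT ht x z
  set p := ⌊(m : ℝ) * t / T⌋₊ with hp
  have h1 : Gdn d n t x z = ∫ r in Set.Ioi (0 : ℝ), gam p r * Gdn d n t x z := by
    rw [integral_mul_const, gam_one, one_mul]
  have h2 : Gdn d n t x z - Gdnm d T n m (t + T / m) x z =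
      ∫ r in Set.Ioi (0 : ℝ), gam p r * (Gdn d n t x z - Gdn d n (T / m * r) x z) := by
    simp only [mul_sub]
    rw [integral_sub ((gam_int p).mul_const _) hi, ← he, ← h1]
  rw [h2]
  refine (enorm_integral_le_lintegral_enorm _).trans ?_
  simp only [enorm_mul, le_refl]

lemma Gdn_meas (d n : ℕ) (s : ℝ) (x : EuclideanSpace ℝ (Fin d)) : Measurable (Gdn d n s x) := by
  unfold Gdn
  apply Finset.measurable_fun_prod
  intro i _
  exact (Gn_meas n s (x i)).comp (by fun_prop)

lemma Gdn_meas2 (d n : ℕ) (h : ℝ) (x : EuclideanSpace ℝ (Fin d)) :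
    Measurable (fun q : EuclideanSpace ℝ (Fin d) × ℝ => Gdn d n (h * q.2) x q.1) := by
  simp only [Gdn_expand]
  apply Finset.measurable_fun_sum
  intro k _
  apply Measurable.mul (by fun_prop)
  apply Measurable.mul (by fun_prop)
  apply Finset.measurable_fun_prod
  intro i _
  exact (phiF_meas _).comp ((kappa_meas n).comp (by fun_prop))

lemma swap_gen {E : Type*} [MeasurableSpace E] (μ : Measure E) [SFinite μ] (g : ℝ → ENNReal) (hg : Measurable g)
    (F : E × ℝ → ENNReal) (hF : Measurable F) (K : E → ENNReal) (hK : Measurable K)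
    (f : E → ENNReal) (hf : ∀ z, f z ≤ ∫⁻ r in Set.Ioi (0 : ℝ), g r * F (z, r)) :
    ∫⁻ z, f z * K z ∂μ ≤ ∫⁻ r in Set.Ioi (0 : ℝ), g r * ∫⁻ z, F (z, r) * K z ∂μ := by
  calc _ ≤ ∫⁻ z, (∫⁻ r in Set.Ioi (0 : ℝ), g r * (F (z, r) * K z)) ∂μ := by
        apply lintegral_mono
        intro z
        simp only [← mul_assoc]
        rw [lintegral_mul_const _ (by fun_prop)]
        gcongr
        exact hf z
    _ = ∫⁻ r in Set.Ioi (0 : ℝ), ∫⁻ z, g r * (F (z, r) * K z) ∂μ := by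
        apply lintegral_lintegral_swap
        apply Measurable.aemeasurable
        unfold Function.uncurry
        fun_prop
    _ = _ := by
        congr 1; ext r
        rw [lintegral_const_mul _ (by fun_prop)]

lemma Wd_swap (d n m : ℕ) (hm : 1 ≤ m) (T t α : ℝ) (hT : 0 < T) (ht : 0 ≤ t)
    (x y : EuclideanSpace ℝ (Fin d)) :
    Wd d α y (fun z => Gdn d n t x z - Gdnm d T n m (t + T / m) x z) ≤
      ∫⁻ r in Set.Ioi (0 : ℝ), ‖gam ⌊(m : ℝ) * t / T⌋₊ r‖ₑ *
        Wd d α y (fun z => Gdn d n t x z - Gdn d n (T / m * r) x z) := by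
  have hF : Measurable (fun q : EuclideanSpace ℝ (Fin d) × ℝ =>
      ‖Gdn d n t x q.1 - Gdn d n (T / m * q.2) x q.1‖ₑ) :=
    (((Gdn_meas d n t x).comp measurable_fst).sub (Gdn_meas2 d n (T / m) x)).enorm
  exact swap_gen (volume.restrict (Q d)) _ (gam_cont ⌊(m : ℝ) * t / T⌋₊).measurable.enorm _ hF
    (fun z => ‖y - z‖ₑ ^ (-α)) (by fun_prop) _ (fun z => diff_enorm d n m hm T t hT ht x z)

/-- decay rate in time -/
noncomputable def rate (h t : ℝ) : ℝ := if t < h then 1 else Real.sqrt (h / t)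

lemma rate_nonneg (h t : ℝ) : 0 ≤ rate h t := by
  unfold rate; split_ifs <;> positivity

lemma Wd_K (T : ℝ) (hT : 0 < T) (d : ℕ) (hd : 1 ≤ d) (α : ℝ) (hα0 : 0 ≤ α) (hα : α < d) (hα2 : α < 2) :
    ∃ C : ℝ, 0 < C ∧ ∀ n : ℕ, 0 < n → ∀ m : ℕ, 1 ≤ m → ∀ t : ℝ, 0 < t → t ≤ T → ∀ x y,
      Wd d α y (fun z => Gdn d n t x z - Gdnm d T n m (t + T / m) x z) ≤
        ENNReal.ofReal (C * (t ^ (-(α / 2)) * rate (T / m) t)) := by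
  obtain ⟨C, hC, hW⟩ := Wd_b T hT d hd α hα0 hα
  have hΓ : 0 < Real.Gamma (1 - α / 2) := Real.Gamma_pos_of_pos (by linarith)
  refine ⟨C * (12 + (1 + Real.Gamma (1 - α / 2))), by positivity, ?_⟩
  intro n hn m hm t ht htT x y
  have hm0 : (0 : ℝ) < m := by exact_mod_cast hm
  have hh : 0 < T / (m : ℝ) := by positivity
  have hta : 0 < t ^ (-(α / 2)) := Real.rpow_pos_of_pos ht _
  refine (Wd_swap d n m hm T t α hT ht.le x y).trans ?_
  set p := ⌊(m : ℝ) * t / T⌋₊ with hp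
  set h := T / (m : ℝ) with hhd
  have hmt : (m : ℝ) * t / T = t / h := by rw [hhd]; field_simp
  have step : ∫⁻ r in Set.Ioi (0 : ℝ), ‖gam p r‖ₑ * Wd d α y (fun z => Gdn d n t x z - Gdn d n (h * r) x z) ≤
      ENNReal.ofReal C *
      ∫⁻ r in Set.Ioi (0 : ℝ), ENNReal.ofReal (gam p r * (eps t (h * r) * (min t (h * r)) ^ (-(α / 2)))) := by
    rw [← lintegral_const_mul' _ _ ENNReal.ofReal_ne_top]
    apply setLIntegral_mono' measurableSet_Ioi
    intro r hr
    have hr0 : (0 : ℝ) < r := hr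
    refine (mul_le_mul' le_rfl (hW n hn t (h * r) ht htT (by positivity) x y)).trans ?_
    have g0 := gam_nonneg p hr0.le
    rw [Real.enorm_of_nonneg g0, ← ENNReal.ofReal_mul g0, ← ENNReal.ofReal_mul hC.le]
    apply ENNReal.ofReal_le_ofReal
    apply le_of_eq; ring
  refine step.trans ?_
  rcases lt_or_ge t h with hlt | hge
  · have hp0 : p = 0 := by
      rw [hp, hmt]
      exact Nat.floor_eq_zero.mpr ((div_lt_one hh).mpr hlt)
    rw [hp0]
    refine (mul_le_mul' le_rfl (case_small (α / 2) h t (by linarith) (by linarith) hh ht hlt.le)).trans ?_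
    rw [← ENNReal.ofReal_mul hC.le]
    apply ENNReal.ofReal_le_ofReal
    rw [rate, if_pos hlt, mul_one, ← mul_assoc]
    have hle : C * (1 + Real.Gamma (1 - α / 2)) ≤ C * (12 + (1 + Real.Gamma (1 - α / 2))) :=
      mul_le_mul_of_nonneg_left (by linarith) hC.le
    exact mul_le_mul_of_nonneg_right hle hta.le
  · have hp1 : 1 ≤ p := by
      rw [hp, hmt]
      apply Nat.le_floor
      rw [Nat.cast_one, le_div_iff₀ hh]; linarith
    have hpl : (p : ℝ) ≤ t / h := by rw [hp, hmt]; exact Nat.floor_le (by positivity)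
    have hpu : t / h < p + 1 := by rw [hp, hmt]; exact Nat.lt_floor_add_one _
    rw [le_div_iff₀ hh] at hpl
    rw [div_lt_iff₀ hh] at hpu
    refine (mul_le_mul' le_rfl (case_large (α / 2) h t p (by linarith) (by linarith) hh hp1
      (by linarith) (by linarith))).trans ?_
    rw [← ENNReal.ofReal_mul hC.le]
    apply ENNReal.ofReal_le_ofReal
    rw [rate, if_neg (not_lt.mpr hge)]
    calc _ = C * 12 * (t ^ (-(α / 2)) * Real.sqrt (h / t)) := by ring
      _ ≤ _ := by gcongr; linarith

lemma kern_real_le {E : Type*} [NormedAddCommGroup E] (α : ℝ) (hα : 0 < α) (w : E) :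
    ‖‖w‖ ^ (-α)‖ₑ ≤ ‖w‖ₑ ^ (-α) := by
  by_cases hw : w = 0
  · subst hw
    rw [enorm_zero, ENNReal.zero_rpow_of_neg (by linarith)]
    exact le_top
  · have h : 0 < ‖w‖ := norm_pos_iff.mpr hw
    rw [Real.enorm_of_nonneg (by positivity), ← ENNReal.ofReal_rpow_of_pos h, ofReal_norm]

lemma normAlpha_le (d : ℕ) (α : ℝ) (hα : 0 < α) (f : EuclideanSpace ℝ (Fin d) → ℝ) (A B : ℝ)
    (hA : 0 ≤ A) (h1 : ∀ y, Wd d α y f ≤ ENNReal.ofReal A)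
    (h0 : Wd d 0 0 f ≤ ENNReal.ofReal B) :
    ‖normAlphaSq d α f‖ₑ ≤ ENNReal.ofReal (A * B) := by
  have hL1 : ∫⁻ z in Q d, ‖f z‖ₑ ≤ ENNReal.ofReal B := by
    simpa [Wd] using h0
  have inner : ∀ y, ‖∫ z in Q d, |f y| * ‖y - z‖ ^ (-α) * |f z|‖ₑ ≤ ENNReal.ofReal A * ‖f y‖ₑ := by
    intro y
    refine (enorm_integral_le_lintegral_enorm _).trans ?_
    calc _ ≤ ∫⁻ z in Q d, ‖f y‖ₑ * (‖f z‖ₑ * ‖y - z‖ₑ ^ (-α)) := by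
          apply lintegral_mono
          intro z
          simp only [enorm_mul, ← Real.norm_eq_abs, enorm_norm]
          rw [mul_assoc, mul_comm (‖‖y - z‖ ^ (-α)‖ₑ)]
          gcongr
          exact kern_real_le α hα _
      _ = ‖f y‖ₑ * Wd d α y f := by
          rw [lintegral_const_mul' _ _ enorm_ne_top]; rfl
      _ ≤ _ := by rw [mul_comm]; gcongr; exact h1 y
  unfold normAlphaSq
  refine (enorm_integral_le_lintegral_enorm _).trans ?_
  refine (lintegral_mono inner).trans ?_
  rw [lintegral_const_mul' _ _ ENNReal.ofReal_ne_top, ENNReal.ofReal_mul hA]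
  gcongr

lemma time_int (a h T K : ℝ) (ha0 : 0 < a) (ha : a < 1) (hh : 0 < h) (hK : 0 ≤ K) :
    ∫⁻ t in Set.Ioc 0 T, ENNReal.ofReal (K * (t ^ (-a) * rate h t ^ 2)) ≤
      ENNReal.ofReal (K * (1 / (1 - a) + 1 / a) * h ^ (1 - a)) := by
  have hsub : Set.Ioc 0 T ⊆ Set.Ioc 0 h ∪ Set.Ioi h := by
    intro t ht
    rcases le_or_gt t h with hc | hc
    · exact Or.inl ⟨ht.1, hc⟩
    · exact Or.inr hc
  refine (lintegral_mono_set hsub).trans ?_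
  refine (lintegral_union_le _ _ _).trans ?_
  have hha : 0 < h ^ (1 - a) := Real.rpow_pos_of_pos hh _
  have p1 : ∫⁻ t in Set.Ioc 0 h, ENNReal.ofReal (K * (t ^ (-a) * rate h t ^ 2)) ≤
      ENNReal.ofReal (K * (h ^ (1 - a) / (1 - a))) := by
    have hii : IntervalIntegrable (fun t : ℝ => t ^ (-a)) volume 0 h :=
      intervalIntegral.intervalIntegrable_rpow' (by linarith)
    have hi : IntegrableOn (fun t : ℝ => K * t ^ (-a)) (Set.Ioc 0 h) :=
      ((intervalIntegrable_iff_integrableOn_Ioc_of_le hh.le).mp hii).const_mul _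
    calc _ ≤ ∫⁻ t in Set.Ioc 0 h, ENNReal.ofReal (K * t ^ (-a)) := by
          apply setLIntegral_mono' measurableSet_Ioc
          intro t ht
          apply ENNReal.ofReal_le_ofReal
          have hr : rate h t ≤ 1 := by
            unfold rate
            split_ifs with hc
            · exact le_rfl
            · have : t = h := le_antisymm ht.2 (not_lt.mp hc)
              rw [this, div_self hh.ne', Real.sqrt_one]
          have hr0 := rate_nonneg h t
          have hta : 0 < t ^ (-a) := Real.rpow_pos_of_pos ht.1 _
          have : rate h t ^ 2 ≤ 1 := by nlinarith
          apply mul_le_mul_of_nonneg_left _ hK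
          nlinarith
      _ = ENNReal.ofReal (∫ t in Set.Ioc 0 h, K * t ^ (-a)) := by
          rw [ofReal_integral_eq_lintegral_ofReal hi]
          refine (ae_restrict_iff' measurableSet_Ioc).mpr (Filter.Eventually.of_forall ?_)
          intro t ht
          exact mul_nonneg hK (Real.rpow_nonneg ht.1.le _)
      _ ≤ _ := by
          rw [integral_const_mul, ← intervalIntegral.integral_of_le hh.le, integral_rpow (Or.inl (by linarith)),
            show -a + 1 = 1 - a by ring, Real.zero_rpow (by linarith), sub_zero]
  have p2 : ∫⁻ t in Set.Ioi h, ENNReal.ofReal (K * (t ^ (-a) * rate h t ^ 2)) ≤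
      ENNReal.ofReal (K * (h ^ (1 - a) / a)) := by
    have hi : IntegrableOn (fun t : ℝ => (K * h) * t ^ (-a - 1)) (Set.Ioi h) :=
      (integrableOn_Ioi_rpow_of_lt (by linarith) hh).const_mul _
    calc _ ≤ ∫⁻ t in Set.Ioi h, ENNReal.ofReal ((K * h) * t ^ (-a - 1)) := by
          apply setLIntegral_mono' measurableSet_Ioi
          intro t ht
          have hht : h < t := ht
          have ht0 : 0 < t := hh.trans hht
          apply ENNReal.ofReal_le_ofReal
          unfold rate
          rw [if_neg (not_lt.mpr hht.le), Real.sq_sqrt (by positivity), Real.rpow_sub_one ht0.ne']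
          apply le_of_eq
          ring
      _ = ENNReal.ofReal (∫ t in Set.Ioi h, (K * h) * t ^ (-a - 1)) := by
          rw [ofReal_integral_eq_lintegral_ofReal hi]
          refine (ae_restrict_iff' measurableSet_Ioi).mpr (Filter.Eventually.of_forall ?_)
          intro t ht
          exact mul_nonneg (mul_nonneg hK hh.le) (Real.rpow_nonneg (hh.trans ht).le _)
      _ ≤ _ := by
          rw [integral_const_mul, integral_Ioi_rpow_of_lt (by linarith) hh]
          apply ENNReal.ofReal_le_ofReal
          apply le_of_eq
          rw [show -a - 1 + 1 = -a by ring, show 1 - a = -a + 1 by ring, Real.rpow_add_one hh.ne']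
          field_simp
  refine (add_le_add p1 p2).trans ?_
  rw [← ENNReal.ofReal_add (by have : 0 < 1 - a := by linarith
                               positivity) (by positivity)]
  apply ENNReal.ofReal_le_ofReal
  apply le_of_eq
  ring

/-- time-integrated `‖·‖_{(α)}²` estimate of `(G_d)^n - (G_d)^{n,m}(·+T/m)`. -/
theorem stmt_17 (d : ℕ) (hd : 1 ≤ d) (T : ℝ) (hT : 0 < T) (α : ℝ)
    (hα : α ∈ Set.Ioo (0 : ℝ) (min 2 (d : ℝ))) :
    ∃ C : ℝ, 0 < C ∧ ∀ n : ℕ, 2 ≤ n → ∀ m : ℕ, 1 ≤ m → ∀ x ∈ Q d,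
      (∫ t in (0 : ℝ)..T,
          normAlphaSq d α (fun y => Gdn d n t x y - Gdnm d T n m (t + T / m) x y))
        ≤ C * (m : ℝ) ^ (-1 + α / 2) := by
  have hα0 : 0 < α := hα.1
  have hα2 : α < 2 := hα.2.trans_le (min_le_left _ _)
  have hαd : α < d := hα.2.trans_le (min_le_right _ _)
  have hd0 : (0 : ℝ) < d := hα0.trans hαd
  obtain ⟨A, hA, h1⟩ := Wd_K T hT d hd α hα0.le hαd hα2
  obtain ⟨B, hB, h0⟩ := Wd_K T hT d hd 0 le_rfl hd0 two_pos
  have ha1 : 0 < 1 - α / 2 := by linarith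
  have hTp : 0 < T ^ (1 - α / 2) := Real.rpow_pos_of_pos hT _
  refine ⟨A * B * (1 / (1 - α / 2) + 1 / (α / 2)) * T ^ (1 - α / 2), by positivity, ?_⟩
  intro n hn m hm x _
  have hm0 : (0 : ℝ) < m := by exact_mod_cast hm
  have hh : 0 < T / (m : ℝ) := by positivity
  have key : ‖∫ t in (0 : ℝ)..T,
          normAlphaSq d α (fun y => Gdn d n t x y - Gdnm d T n m (t + T / m) x y)‖ₑ ≤
      ENNReal.ofReal (A * B * (1 / (1 - α / 2) + 1 / (α / 2)) * (T / m) ^ (1 - α / 2)) := by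
    rw [intervalIntegral.integral_of_le hT.le]
    refine (enorm_integral_le_lintegral_enorm _).trans ?_
    refine le_trans ?_ (time_int (α / 2) (T / m) T (A * B) (by linarith) (by linarith) hh (by positivity))
    apply setLIntegral_mono' measurableSet_Ioc
    intro t ht
    have hr := rate_nonneg (T / m) t
    have hta : 0 < t ^ (-(α / 2)) := Real.rpow_pos_of_pos ht.1 _
    refine (normAlpha_le d α hα0 _ _ _ (by positivity)
      (fun y => h1 n (by omega) m hm t ht.1 ht.2 x y) (h0 n (by omega) m hm t ht.1 ht.2 x 0)).trans ?_
    apply ENNReal.ofReal_le_ofReal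
    apply le_of_eq
    simp
    ring
  rw [Real.enorm_eq_ofReal_abs, ENNReal.ofReal_le_ofReal_iff (by positivity)] at key
  refine (le_abs_self _).trans (key.trans (le_of_eq ?_))
  rw [Real.div_rpow hT.le hm0.le, show -1 + α / 2 = -(1 - α / 2) by ring, Real.rpow_neg hm0.le]
  ring
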